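/- arXiv:2601.03212 — 9 statements merged into one kernel-verified Lean document; each statement's English description precedes it below -/
import Mathlib

section
/- If 𝒞 is an irredundant covering of ℤ², then every lattice in 𝒞 is cocyclic. -/
/-- `ℤ²` as the free abelian group of rank 2. -/
abbrev Z2 := ℤ × ℤ

/-- A subgroup of `ℤ²` is diagonal with respect to a suitable basis. -/
lemma Z2.exists_diagonal_basis (L : AddSubgroup Z2) :
    ∃ (e : Module.Basis (Fin 2) ℤ Z2) (a : Fin 2 → ℤ),
      (∀ i, a i • e i ∈ L) ∧ ∀ m ∈ L, ∀ i, a i ∣ e.repr m i := by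
  obtain ⟨n, s⟩ := Submodule.smithNormalForm (Module.Basis.finTwoProd ℤ) L.toIntSubmodule
  refine ⟨s.bM, Function.extend s.f s.a 0, fun i ↦ ?_, fun m hm i ↦ ?_⟩
  · by_cases h : ∃ j, s.f j = i
    · obtain ⟨j, rfl⟩ := h
      rw [s.f.injective.extend_apply, ← s.snf j]
      exact (s.bN j).2
    · rw [Function.extend_apply' _ _ _ h, Pi.zero_apply, zero_smul]
      exact L.zero_mem
  · by_cases h : ∃ j, s.f j = i
    · obtain ⟨j, rfl⟩ := h
      rw [s.f.injective.extend_apply,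
        s.repr_apply_embedding_eq_repr_smul (⟨m, hm⟩ : L.toIntSubmodule), map_smul]
      exact ⟨_, rfl⟩
    · rw [s.repr_eq_zero_of_notMem_range (⟨m, hm⟩ : L.toIntSubmodule) h]
      exact dvd_zero _

/-- A subgroup of `ℤ²` with non-cyclic quotient is contained in `pℤ²` for some prime `p`. -/
lemma Z2.exists_prime_of_not_isAddCyclic_quotient (L : AddSubgroup Z2)
    (hL : ¬ IsAddCyclic (Z2 ⧸ L)) :
    ∃ p : ℕ, p.Prime ∧ ∀ m ∈ L, ∃ w : Z2, m = (p : ℤ) • w := by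
  obtain ⟨e, a, haL, hdvd⟩ := Z2.exists_diagonal_basis L
  have hcop : ¬ IsCoprime (a 0) (a 1) := by
    rintro ⟨u, v, huv⟩
    refine hL ⟨⟨QuotientAddGroup.mk (-v • e 0 + u • e 1), fun q ↦ ?_⟩⟩
    induction q using QuotientAddGroup.induction_on with | H x => ?_
    obtain ⟨x₀, x₁, rfl⟩ : ∃ x₀ x₁ : ℤ, x = x₀ • e 0 + x₁ • e 1 :=
      ⟨e.repr x 0, e.repr x 1, by simpa [Fin.sum_univ_two] using (e.sum_repr x).symm⟩
    refine ⟨-a 1 * x₀ + a 0 * x₁, ?_⟩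
    change ((_ : ℤ) • (QuotientAddGroup.mk _ : Z2 ⧸ L)) = _
    rw [← QuotientAddGroup.mk_zsmul, QuotientAddGroup.eq]
    have hmem := L.zsmul_mem (L.add_mem (haL 0) (haL 1)) (u * x₀ + v * x₁)
    convert hmem using 1
    match_scalars
    · linear_combination -x₀ * huv
    · linear_combination -x₁ * huv
  rw [Int.isCoprime_iff_gcd_eq_one] at hcop
  obtain ⟨p, hp, hpd⟩ := Nat.exists_prime_and_dvd hcop
  have hpa : ∀ i, (p : ℤ) ∣ a i := by
    have h := Int.natCast_dvd_natCast.mpr hpd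
    exact Fin.forall_fin_two.mpr
      ⟨h.trans (Int.gcd_dvd_left ..), h.trans (Int.gcd_dvd_right ..)⟩
  refine ⟨p, hp, fun m hm ↦ ?_⟩
  choose c hc using fun i ↦ (hpa i).trans (hdvd m hm i)
  refine ⟨∑ i, c i • e i, ?_⟩
  rw [Finset.smul_sum, ← e.sum_repr m]
  exact Finset.sum_congr rfl fun i _ ↦ by rw [hc, mul_smul]

/-- In an irredundant covering of `ℤ²` by lattices
(finite-index subgroups), every lattice is cocyclic (has cyclic quotient). -/
theorem irredundant_covering_all_cocyclic (C : Finset (AddSubgroup Z2))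
    (hlat : ∀ L ∈ C, L.index ≠ 0)
    (hcov : ∀ v : Z2, ∃ L ∈ C, v ∈ L)
    (hirr : ∀ L ∈ C, ∃ v ∈ L, ∀ L' ∈ C, L' ≠ L → v ∉ L') :
    ∀ L ∈ C, IsAddCyclic (Z2 ⧸ L) := by
  intro L hLC
  by_contra hL
  obtain ⟨p, hp, hpL⟩ := Z2.exists_prime_of_not_isAddCyclic_quotient L hL
  have key : ∀ (n : ℕ) (v : Z2), v.1.natAbs + v.2.natAbs = n →
      ∃ L' ∈ C, L' ≠ L ∧ v ∈ L' := by
    intro n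
    induction n using Nat.strong_induction_on with | _ n ih => ?_
    intro v hv
    by_cases hvL : v ∈ L
    · obtain ⟨w, rfl⟩ := hpL v hvL
      by_cases hw : w = 0
      · obtain ⟨L', hL', h⟩ := hcov (1, 0)
        refine ⟨L', hL', ?_, by simp [hw, L'.zero_mem]⟩
        rintro rfl
        obtain ⟨u, hu⟩ := hpL _ h
        have h₁ : (p : ℤ) ∣ 1 := ⟨u.1, by simpa using congrArg Prod.fst hu⟩
        exact hp.one_lt.ne' (by exact_mod_cast Int.eq_one_of_dvd_one (by positivity) h₁)
      · have hpos : 0 < w.1.natAbs + w.2.natAbs := by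
          by_contra h
          exact hw (Prod.ext (by simp; omega) (by simp; omega))
        obtain ⟨L', hL', hne, hmem⟩ := ih (w.1.natAbs + w.2.natAbs) (by
          simp only [Prod.smul_fst, Prod.smul_snd, smul_eq_mul, Int.natAbs_mul,
            Int.natAbs_natCast] at hv
          nlinarith [hp.two_le]) w rfl
        exact ⟨L', hL', hne, L'.zsmul_mem hmem _⟩
    · obtain ⟨L', hL', h⟩ := hcov v
      exact ⟨L', hL', fun h' ↦ hvL (h' ▸ h), h⟩
  obtain ⟨v, -, hv⟩ := hirr L hLC
  obtain ⟨L', hL', hne, hmem⟩ := key _ v rfl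
  exact hv L' hL' hne hmem
end

section
/- Every cocyclic lattice in ℤ² has a ℤ-basis consisting of two primitive vectors; consequently, two cocyclic lattices in ℤ² that contain exactly the same primitive vectors are equal. -/
theorem Int.exists_eq_mul_isCoprime (a b : ℤ) :
    ∃ d a' b' : ℤ, a = d * a' ∧ b = d * b' ∧ IsCoprime a' b' := by
  by_cases h : Int.gcd a b = 0
  · obtain ⟨rfl, rfl⟩ := Int.gcd_eq_zero_iff.mp h
    exact ⟨0, 1, 0, by simp, by simp, isCoprime_one_left⟩
  · obtain ⟨a', b', hab, ha, hb⟩ := Int.exists_gcd_one (Nat.pos_of_ne_zero h)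
    exact ⟨Int.gcd a b, a', b', by rw [mul_comm]; exact ha, by rw [mul_comm]; exact hb,
      Int.isCoprime_iff_gcd_eq_one.mpr hab⟩

/-- A cocyclic lattice in `ℤ²` is the kernel of a linear congruence with coprime coefficients. -/
theorem AddSubgroup.exists_mem_iff_dvd_of_isAddCyclic (L : AddSubgroup Z2) (hL : L.index ≠ 0)
    (hc : IsAddCyclic (Z2 ⧸ L)) :
    ∃ n a b : ℤ, n ≠ 0 ∧ IsCoprime a b ∧ ∀ u : Z2, u ∈ L ↔ n ∣ a * u.1 + b * u.2 := by
  have : L.FiniteIndex := ⟨hL⟩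
  obtain ⟨g, hg⟩ := hc.exists_generator
  obtain ⟨a, ha⟩ := AddSubgroup.mem_zmultiples_iff.mp (hg (QuotientAddGroup.mk ((1, 0) : Z2)))
  obtain ⟨b, hb⟩ := AddSubgroup.mem_zmultiples_iff.mp (hg (QuotientAddGroup.mk ((0, 1) : Z2)))
  have hmk (u : Z2) : (QuotientAddGroup.mk u : Z2 ⧸ L) = (a * u.1 + b * u.2) • g := by
    have hu : u = u.1 • ((1, 0) : Z2) + u.2 • ((0, 1) : Z2) := by ext <;> simp
    conv_lhs => rw [hu]
    rw [QuotientAddGroup.mk_add, QuotientAddGroup.mk_zsmul, QuotientAddGroup.mk_zsmul, ← ha, ← hb,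
      add_zsmul, mul_zsmul', mul_zsmul']
  have hmem (u : Z2) : u ∈ L ↔ (addOrderOf g : ℤ) ∣ a * u.1 + b * u.2 := by
    rw [← QuotientAddGroup.eq_zero_iff, hmk, addOrderOf_dvd_iff_zsmul_eq_zero]
  obtain ⟨d, a', b', rfl, rfl, hab⟩ := Int.exists_eq_mul_isCoprime a b
  refine ⟨addOrderOf g, a', b', ?_, hab, fun u ↦ ?_⟩
  · exact_mod_cast (addOrderOf_pos g).ne'
  · have hd : IsCoprime (addOrderOf g : ℤ) d := by
      obtain ⟨w, rfl⟩ := QuotientAddGroup.mk_surjective g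
      set g : Z2 ⧸ L := QuotientAddGroup.mk w
      have h : (addOrderOf g : ℤ) ∣ d * a' * w.1 + d * b' * w.2 - 1 := by
        rw [addOrderOf_dvd_iff_zsmul_eq_zero, sub_zsmul, ← hmk w, one_zsmul]
        exact add_neg_cancel g
      obtain ⟨k, hk⟩ := h
      exact ⟨-k, a' * w.1 + b' * w.2, by linear_combination hk⟩
    rw [hmem, show d * a' * u.1 + d * b' * u.2 = d * (a' * u.1 + b' * u.2) by ring]
    exact ⟨hd.dvd_of_dvd_mul_left, fun h ↦ h.mul_left d⟩

theorem AddSubgroup.exists_primitive_basis (L : AddSubgroup Z2) (hL : L.index ≠ 0)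
    (hc : IsAddCyclic (Z2 ⧸ L)) :
    ∃ v w : Z2, IsCoprime v.1 v.2 ∧ IsCoprime w.1 w.2 ∧ v ∈ L ∧ w ∈ L ∧
      ∀ u ∈ L, ∃! c : ℤ × ℤ, c.1 • v + c.2 • w = u := by
  obtain ⟨n, a, b, hn, ⟨p, q, hpq⟩, hmem⟩ := L.exists_mem_iff_dvd_of_isAddCyclic hL hc
  refine ⟨(-b, a), (-b + n * p, a + n * q), ⟨-q, p, by linear_combination hpq⟩,
    ⟨-q, p, by linear_combination hpq⟩, (hmem _).mpr ⟨0, by ring⟩,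
    (hmem _).mpr ⟨1, by linear_combination n * hpq⟩, ?_⟩
  rintro ⟨x, y⟩ hu
  obtain ⟨k, hk⟩ := (hmem _).mp hu
  dsimp only at hk
  refine ⟨(-q * x + p * y - k, k), ?_, ?_⟩
  · ext
    · simp only [Prod.smul_mk, Prod.mk_add_mk, smul_eq_mul]
      linear_combination x * hpq - p * hk
    · simp only [Prod.smul_mk, Prod.mk_add_mk, smul_eq_mul]
      linear_combination y * hpq - q * hk
  · rintro ⟨c, d⟩ h
    simp only [Prod.smul_mk, Prod.mk_add_mk, smul_eq_mul, Prod.mk.injEq] at h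
    obtain ⟨h₁, h₂⟩ := h
    have hd : d = k := mul_left_cancel₀ hn (by
      linear_combination a * h₁ + b * h₂ + hk - n * d * hpq)
    subst hd
    ext
    · dsimp only
      linear_combination p * h₂ - q * h₁ - (c + d) * hpq
    · rfl

theorem AddSubgroup.le_of_primitive_mem (L₁ L₂ : AddSubgroup Z2) (hL : L₁.index ≠ 0)
    (hc : IsAddCyclic (Z2 ⧸ L₁)) (h : ∀ v : Z2, IsCoprime v.1 v.2 → v ∈ L₁ → v ∈ L₂) :
    L₁ ≤ L₂ := by
  obtain ⟨v, w, hv, hw, hvL, hwL, hspan⟩ := L₁.exists_primitive_basis hL hc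
  intro u hu
  obtain ⟨c, rfl, -⟩ := hspan u hu
  exact add_mem (zsmul_mem (h v hv hvL) _) (zsmul_mem (h w hw hwL) _)

/-- Every cocyclic lattice in `ℤ²` has a `ℤ`-basis consisting of two
primitive vectors; consequently, two cocyclic lattices containing exactly the same
primitive vectors are equal. -/
theorem cocyclic_lattice_primitive_basis :
    (∀ L : AddSubgroup Z2, L.index ≠ 0 → IsAddCyclic (Z2 ⧸ L) →
      ∃ v w : Z2, IsCoprime v.1 v.2 ∧ IsCoprime w.1 w.2 ∧ v ∈ L ∧ w ∈ L ∧
        ∀ u ∈ L, ∃! c : ℤ × ℤ, c.1 • v + c.2 • w = u) ∧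
    (∀ L₁ L₂ : AddSubgroup Z2, L₁.index ≠ 0 → L₂.index ≠ 0 →
      IsAddCyclic (Z2 ⧸ L₁) → IsAddCyclic (Z2 ⧸ L₂) →
      (∀ v : Z2, IsCoprime v.1 v.2 → (v ∈ L₁ ↔ v ∈ L₂)) → L₁ = L₂) := by
  refine ⟨AddSubgroup.exists_primitive_basis, fun L₁ L₂ h₁ h₂ hc₁ hc₂ h ↦ le_antisymm ?_ ?_⟩
  · exact L₁.le_of_primitive_mem L₂ h₁ hc₁ fun v hv ↦ (h v hv).mp
  · exact L₂.le_of_primitive_mem L₁ h₂ hc₂ fun v hv ↦ (h v hv).mpr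
end

section
/- Let N₁ and N₂ be coprime positive integers and N = N₁N₂. The map (L₁, L₂) ↦ L₁ ∩ L₂ is a bijection from the set of pairs of lattices in ℤ² with [ℤ² : Lᵢ] = Nᵢ (i = 1, 2) onto the set of lattices in ℤ² of index N; moreover, in this bijection L₁ ∩ L₂ is cocyclic if and only if both L₁ and L₂ are cocyclic. -/
/-- Pairs of lattices in `ℤ²` with prescribed indices `N₁` and `N₂`. -/
def LatticePairs (N₁ N₂ : ℕ) : Type :=
  {P : AddSubgroup Z2 × AddSubgroup Z2 // P.1.index = N₁ ∧ P.2.index = N₂}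

/-- Lattices in `ℤ²` with prescribed index `N`. -/
def Lattices (N : ℕ) : Type :=
  {L : AddSubgroup Z2 // L.index = N}

namespace AddSubgroup

variable {A : Type*} [AddCommGroup A]

theorem index_nsmul_mem (H : AddSubgroup A) (a : A) : H.index • a ∈ H := by
  rw [← QuotientAddGroup.eq_zero_iff, QuotientAddGroup.mk_nsmul, index_eq_card]
  exact card_nsmul_eq_zero'

theorem index_inf_of_coprime {H K : AddSubgroup A} (hH : H.index ≠ 0) (hK : K.index ≠ 0)
    (h : H.index.Coprime K.index) : (H ⊓ K).index = H.index * K.index :=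
  index_inf_le.antisymm <| Nat.le_of_dvd (Nat.pos_of_ne_zero (index_inf_ne_zero hH hK)) <|
    h.mul_dvd_of_dvd_of_dvd (index_dvd_of_le inf_le_left) (index_dvd_of_le inf_le_right)

/-- The elements whose `n`-th multiple lies in `L`. -/
def nsmulComap (n : ℕ) (L : AddSubgroup A) : AddSubgroup A :=
  L.comap (nsmulAddMonoidHom n)

theorem mem_nsmulComap {n : ℕ} {L : AddSubgroup A} {x : A} :
    x ∈ nsmulComap n L ↔ n • x ∈ L :=
  Iff.rfl

theorem le_nsmulComap (n : ℕ) (L : AddSubgroup A) : L ≤ nsmulComap n L :=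
  fun _ hx ↦ nsmul_mem hx n

theorem mem_of_coprime_nsmul_mem {m n : ℕ} (hmn : m.Coprime n) {L : AddSubgroup A} {x : A}
    (hm : m • x ∈ L) (hn : n • x ∈ L) : x ∈ L := by
  have key : x = m.gcdA n • (m • x) + m.gcdB n • (n • x) := by
    have h := Nat.gcd_eq_gcd_ab m n
    rw [hmn.gcd_eq_one] at h
    rw [← natCast_zsmul x m, ← natCast_zsmul x n, smul_smul, smul_smul, ← add_smul,
      mul_comm (m.gcdA n), mul_comm (m.gcdB n), ← h]
    simp
  rw [key]
  exact add_mem (zsmul_mem hm _) (zsmul_mem hn _)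

theorem nsmulComap_inf_nsmulComap {m n : ℕ} (hmn : m.Coprime n) (L : AddSubgroup A) :
    nsmulComap n L ⊓ nsmulComap m L = L :=
  le_antisymm (fun _ hx ↦ mem_of_coprime_nsmul_mem hmn hx.2 hx.1)
    (le_inf (le_nsmulComap n L) (le_nsmulComap m L))

theorem nsmulComap_inf {m n : ℕ} (hmn : m.Coprime n) {H K : AddSubgroup A}
    (hH : H.index = m) (hK : K.index = n) : nsmulComap n (H ⊓ K) = H := by
  refine le_antisymm (fun x hx ↦ ?_) fun x hx ↦ ⟨nsmul_mem hx n, ?_⟩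
  · exact mem_of_coprime_nsmul_mem hmn (hH ▸ index_nsmul_mem H x) hx.1
  · exact hK ▸ index_nsmul_mem K x

theorem coprime_index_of_nsmul_mem {m n : ℕ} (hmn : m.Coprime n) {H : AddSubgroup A}
    (h0 : H.index ≠ 0) (h : ∀ x, m • x ∈ H) : H.index.Coprime n := by
  have : Finite (A ⧸ H) := index_ne_zero_iff_finite.1 h0
  refine Nat.Coprime.symm (Nat.coprime_of_dvd fun p hp hpn hpH ↦ ?_)
  have : Fact p.Prime := ⟨hp⟩
  obtain ⟨y, hy⟩ := exists_prime_addOrderOf_dvd_card' p hpH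
  obtain ⟨x, rfl⟩ := QuotientAddGroup.mk_surjective y
  have hpm : p ∣ m := by
    rw [← hy, addOrderOf_dvd_iff_nsmul_eq_zero, ← QuotientAddGroup.mk_nsmul,
      QuotientAddGroup.eq_zero_iff]
    exact h x
  exact hp.one_lt.ne' (Nat.eq_one_of_dvd_coprimes hmn hpm hpn)

theorem index_nsmulComap {m n : ℕ} (hm : 0 < m) (hn : 0 < n) (hmn : m.Coprime n)
    {L : AddSubgroup A} (hL : L.index = m * n) : (nsmulComap n L).index = m := by
  have h0 : L.index ≠ 0 := hL ▸ (Nat.mul_pos hm hn).ne'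
  have h1 : (nsmulComap n L).index ≠ 0 := fun h ↦ h0 <| by
    simpa [h] using index_dvd_of_le (le_nsmulComap n L)
  have h2 : (nsmulComap m L).index ≠ 0 := fun h ↦ h0 <| by
    simpa [h] using index_dvd_of_le (le_nsmulComap m L)
  have c1 : (nsmulComap n L).index.Coprime n := coprime_index_of_nsmul_mem hmn h1 fun x ↦ by
    rw [mem_nsmulComap, smul_smul, mul_comm, ← hL]
    exact index_nsmul_mem L x
  have c2 : (nsmulComap m L).index.Coprime m := coprime_index_of_nsmul_mem hmn.symm h2 fun x ↦ by
    rw [mem_nsmulComap, smul_smul, ← hL]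
    exact index_nsmul_mem L x
  have d1 : (nsmulComap n L).index ∣ m :=
    c1.dvd_of_dvd_mul_right (hL ▸ index_dvd_of_le (le_nsmulComap n L))
  have d2 : m ∣ (nsmulComap n L).index := by
    refine c2.symm.dvd_of_dvd_mul_right ?_
    rw [← index_inf_of_coprime h1 h2 (c2.symm.coprime_dvd_left d1),
      nsmulComap_inf_nsmulComap hmn, hL]
    exact dvd_mul_right m n
  exact d1.antisymm d2

theorem isAddCyclic_quotient_of_le {H K : AddSubgroup A} (h : H ≤ K) [IsAddCyclic (A ⧸ H)] :
    IsAddCyclic (A ⧸ K) :=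
  isAddCyclic_of_surjective (QuotientAddGroup.map H K (AddMonoidHom.id A) h)
    (QuotientAddGroup.map_surjective_of_surjective H K (AddMonoidHom.id A)
      QuotientAddGroup.mk_surjective h)

theorem isAddCyclic_quotient_inf {H K : AddSubgroup A} (h : H.index.Coprime K.index)
    (hH : IsAddCyclic (A ⧸ H)) (hK : IsAddCyclic (A ⧸ K)) : IsAddCyclic (A ⧸ (H ⊓ K)) := by
  have : IsAddCyclic ((A ⧸ H) × (A ⧸ K)) := AddGroup.isAddCyclic_prod_iff.2 ⟨hH, hK, h⟩
  let g : A →+ (A ⧸ H) × (A ⧸ K) := (QuotientAddGroup.mk' H).prod (QuotientAddGroup.mk' K)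
  have hg : g.ker = H ⊓ K := by simp [g, AddMonoidHom.ker_prod]
  have := isAddCyclic_of_injective (QuotientAddGroup.kerLift g)
    (QuotientAddGroup.kerLift_injective g)
  exact isAddCyclic_quotient_of_le hg.le

end AddSubgroup

/-- For coprime `N₁, N₂`, the map `(L₁, L₂) ↦ L₁ ∩ L₂` is a bijection
from pairs of lattices of indices `N₁` and `N₂` onto lattices of index `N₁ * N₂`, and
in this bijection `L₁ ∩ L₂` is cocyclic iff both `L₁` and `L₂` are. -/
theorem lattice_CRT (N₁ N₂ : ℕ) (h₁ : 0 < N₁) (h₂ : 0 < N₂)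
    (hco : Nat.Coprime N₁ N₂) :
    ∃ f : LatticePairs N₁ N₂ ≃ Lattices (N₁ * N₂),
      (∀ P : LatticePairs N₁ N₂, (f P).val = P.val.1 ⊓ P.val.2) ∧
      (∀ P : LatticePairs N₁ N₂,
        (IsAddCyclic (Z2 ⧸ (P.val.1 ⊓ P.val.2)) ↔
          IsAddCyclic (Z2 ⧸ P.val.1) ∧ IsAddCyclic (Z2 ⧸ P.val.2))) := by
  refine ⟨⟨fun P ↦ ⟨P.val.1 ⊓ P.val.2, ?_⟩,
    fun L ↦ ⟨(L.val.nsmulComap N₂, L.val.nsmulComap N₁), ?_, ?_⟩, ?_, ?_⟩,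
    fun P ↦ rfl, fun P ↦ ⟨fun h ↦ ⟨?_, ?_⟩, fun h ↦ ?_⟩⟩
  · obtain ⟨⟨H, K⟩, rfl, rfl⟩ := P
    exact AddSubgroup.index_inf_of_coprime h₁.ne' h₂.ne' hco
  · exact AddSubgroup.index_nsmulComap h₁ h₂ hco L.property
  · exact AddSubgroup.index_nsmulComap h₂ h₁ hco.symm (L.property.trans (mul_comm _ _))
  · rintro ⟨⟨H, K⟩, hH, hK⟩
    refine Subtype.ext (Prod.ext (AddSubgroup.nsmulComap_inf hco hH hK) ?_)
    change AddSubgroup.nsmulComap N₁ (H ⊓ K) = K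
    rw [inf_comm]
    exact AddSubgroup.nsmulComap_inf hco.symm hK hH
  · exact fun L ↦ Subtype.ext (AddSubgroup.nsmulComap_inf_nsmulComap hco L.val)
  · exact AddSubgroup.isAddCyclic_quotient_of_le (inf_le_left : P.val.1 ⊓ P.val.2 ≤ _)
  · exact AddSubgroup.isAddCyclic_quotient_of_le (inf_le_right : P.val.1 ⊓ P.val.2 ≤ _)
  · refine AddSubgroup.isAddCyclic_quotient_inf ?_ h.1 h.2
    rwa [P.property.1, P.property.2]
end

section
/- Let L₁ and L₂ be cocyclic lattices in ℤ² of indices N₁ and N₂ respectively with N₁ ∣ N₂. Then either L₂ ⊆ L₁, or L₁ and L₂ are separated (that is, their intersection is not cocyclic, equivalently they contain no common primitive vector). -/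
theorem isAddCyclic_quotient_iff {G : Type*} [AddCommGroup G] (L : AddSubgroup G) :
    IsAddCyclic (G ⧸ L) ↔ ∃ w : G, ∀ v : G, ∃ k : ℤ, v - k • w ∈ L := by
  have key (v w : G) (k : ℤ) : k • (w : G ⧸ L) = (v : G ⧸ L) ↔ v - k • w ∈ L := by
    rw [← QuotientAddGroup.mk_zsmul, QuotientAddGroup.eq, neg_add_eq_sub]
  constructor
  · rintro ⟨g, hg⟩
    obtain ⟨w, rfl⟩ := QuotientAddGroup.mk_surjective g
    refine ⟨w, fun v => ?_⟩
    obtain ⟨k, hk⟩ := hg (v : G ⧸ L)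
    exact ⟨k, (key v w k).1 hk⟩
  · rintro ⟨w, hw⟩
    refine ⟨(w : G ⧸ L), fun q => ?_⟩
    obtain ⟨v, rfl⟩ := QuotientAddGroup.mk_surjective q
    obtain ⟨k, hk⟩ := hw v
    exact ⟨k, (key v w k).2 hk⟩

theorem zsmul_mem_iff_index_dvd {G : Type*} [AddCommGroup G] {L : AddSubgroup G} {w : G}
    (hw : ∀ v : G, ∃ k : ℤ, v - k • w ∈ L) (k : ℤ) :
    k • w ∈ L ↔ (L.index : ℤ) ∣ k := by
  have hgen (q : G ⧸ L) : q ∈ AddSubgroup.zmultiples (w : G ⧸ L) := by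
    obtain ⟨v, rfl⟩ := QuotientAddGroup.mk_surjective q
    obtain ⟨k, hk⟩ := hw v
    refine ⟨k, ?_⟩
    change k • (w : G ⧸ L) = (v : G ⧸ L)
    rwa [← QuotientAddGroup.mk_zsmul, QuotientAddGroup.eq, neg_add_eq_sub]
  rw [AddSubgroup.index, ← addOrderOf_eq_card_of_forall_mem_zmultiples hgen,
    addOrderOf_dvd_iff_zsmul_eq_zero, ← QuotientAddGroup.mk_zsmul,
    QuotientAddGroup.eq_zero_iff]

theorem le_of_isAddCyclic_quotient_inf {G : Type*} [AddCommGroup G] {L₁ L₂ : AddSubgroup G}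
    (hdvd : L₁.index ∣ L₂.index) (hc : IsAddCyclic (G ⧸ (L₁ ⊓ L₂))) : L₂ ≤ L₁ := by
  obtain ⟨w, hw⟩ := (isAddCyclic_quotient_iff _).1 hc
  intro v hv
  obtain ⟨k, hk₁, hk₂⟩ := hw v
  have hkw₂ : k • w ∈ L₂ := by simpa using L₂.sub_mem hv hk₂
  rw [zsmul_mem_iff_index_dvd fun v => (hw v).imp fun _ h => h.2] at hkw₂
  have hkw₁ : k • w ∈ L₁ := by
    rw [zsmul_mem_iff_index_dvd fun v => (hw v).imp fun _ h => h.1]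
    exact (Int.natCast_dvd_natCast.2 hdvd).trans hkw₂
  simpa using L₁.add_mem hk₁ hkw₁

theorem isAddCyclic_quotient_of_isCoprime_mem {L : AddSubgroup Z2} {v : Z2}
    (hv : IsCoprime v.1 v.2) (hL : v ∈ L) : IsAddCyclic (Z2 ⧸ L) := by
  obtain ⟨a, b⟩ := v
  obtain ⟨u, t, h⟩ := hv
  refine (isAddCyclic_quotient_iff L).2 ⟨(-t, u), fun ⟨x, y⟩ => ⟨a * y - b * x, ?_⟩⟩
  convert L.zsmul_mem hL (u * x + t * y) using 1
  ext
  · simp only [Prod.fst_sub, Prod.smul_fst, smul_eq_mul] at h ⊢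
    linear_combination -x * h
  · simp only [Prod.snd_sub, Prod.smul_snd, smul_eq_mul] at h ⊢
    linear_combination -y * h

/-- If `L₁, L₂` are cocyclic lattices of indices `N₁ ∣ N₂`, then either
`L₂ ⊆ L₁`, or `L₁` and `L₂` are separated: their intersection is not cocyclic and,
equivalently, they contain no common primitive vector. -/
theorem contain_or_separated (L₁ L₂ : AddSubgroup Z2) (N₁ N₂ : ℕ)
    (h₁ : L₁.index = N₁) (h₂ : L₂.index = N₂) (hN₁ : N₁ ≠ 0) (hN₂ : N₂ ≠ 0)
    (hc₁ : IsAddCyclic (Z2 ⧸ L₁)) (hc₂ : IsAddCyclic (Z2 ⧸ L₂))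
    (hdvd : N₁ ∣ N₂) :
    L₂ ≤ L₁ ∨
      (¬ IsAddCyclic (Z2 ⧸ (L₁ ⊓ L₂)) ∧
        ∀ v : Z2, IsCoprime v.1 v.2 → ¬ (v ∈ L₁ ∧ v ∈ L₂)) := by
  refine or_iff_not_imp_left.2 fun hle => ?_
  have hnc : ¬ IsAddCyclic (Z2 ⧸ (L₁ ⊓ L₂)) := fun hc =>
    hle (le_of_isAddCyclic_quotient_inf (by rwa [h₁, h₂]) hc)
  exact ⟨hnc, fun v hv hmem => hnc (isAddCyclic_quotient_of_isCoprime_mem hv hmem)⟩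
end

section
/- There is no minimal covering of ℤ² of size 2, and every minimal covering of ℤ² of size 3 is equal to the set of all three subgroups of ℤ² of index 2. -/
open Classical

/-- A covering of `ℤ²`: a finite collection of finite-index subgroups whose union is `ℤ²`. -/
def IsCovering (C : Finset (AddSubgroup Z2)) : Prop :=
  (∀ L ∈ C, L.index ≠ 0) ∧ ∀ v : Z2, ∃ L ∈ C, v ∈ L

/-- A covering is minimal if replacing any member by a proper finite-index subgroup of it
destroys the covering property. -/
noncomputable def MinimalCovering (C : Finset (AddSubgroup Z2)) : Prop :=
  IsCovering C ∧
    ∀ L ∈ C, ∀ L' : AddSubgroup Z2, L' < L → L'.index ≠ 0 →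
      ¬ IsCovering (insert L' (C.erase L))

/-- Every finite-index subgroup of `ℤ²` has a proper finite-index subgroup. -/
lemma exists_lt_index_ne_zero (L : AddSubgroup Z2) (hL : L.index ≠ 0) :
    ∃ L' < L, L'.index ≠ 0 := by
  have hK : ((AddSubgroup.zmultiples (2 * (L.index : ℤ))).comap
      (AddMonoidHom.fst ℤ ℤ)).index ≠ 0 := by
    rw [AddSubgroup.index_comap_of_surjective _ Prod.fst_surjective, Int.index_zmultiples]
    simpa using hL
  refine ⟨L ⊓ _, lt_of_le_of_ne inf_le_left fun h => ?_, AddSubgroup.index_inf_ne_zero hL hK⟩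
  have hmem : L.index • ((1, 0) : Z2) ∈ L := L.nsmul_index_mem _
  have hdvd := Int.mem_zmultiples_iff.mp (inf_eq_left.mp h hmem)
  have hle := Int.le_of_dvd (by simp; omega) hdvd
  simp at hle
  omega

/-- Every member of a minimal covering contains a vector lying in no other member. -/
lemma MinimalCovering.exists_forall_notMem {C : Finset (AddSubgroup Z2)}
    (h : MinimalCovering C) {L : AddSubgroup Z2} (hL : L ∈ C) :
    ∃ v : Z2, ∀ M ∈ C, M ≠ L → v ∉ M := by
  by_contra! hcov
  obtain ⟨L', hlt, hL'⟩ := exists_lt_index_ne_zero L (h.1.1 L hL)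
  refine h.2 L hL L' hlt hL' ⟨?_, fun v => ?_⟩
  · intro M hM
    rcases Finset.mem_insert.mp hM with rfl | hM
    · exact hL'
    · exact h.1.1 M (Finset.mem_of_mem_erase hM)
  · obtain ⟨M, hM, hne, hv⟩ := hcov v
    exact ⟨M, Finset.mem_insert_of_mem (Finset.mem_erase.mpr ⟨hne, hM⟩), hv⟩

section Union

variable {G : Type*} [AddCommGroup G] {A B D : AddSubgroup G}

/-- If three subgroups cover an abelian group and none is redundant, each has index two. -/
lemma index_eq_two_of_union_three (hcov : ∀ v, v ∈ A ∨ v ∈ B ∨ v ∈ D)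
    {a b d : G} (haB : a ∉ B) (haD : a ∉ D) (hbA : b ∉ A) (hbD : b ∉ D)
    (hdA : d ∉ A) (hdB : d ∉ B) : A.index = 2 := by
  have hb : b ∈ B := by have := hcov b; tauto
  have hd : d ∈ D := by have := hcov d; tauto
  have ha : a ∈ A := by have := hcov a; tauto
  have hBD : ∀ t ∈ B, t ∈ D → t ∈ A := by
    intro t htB htD
    have h := hcov (a + t)
    rwa [B.add_mem_cancel_right htB, D.add_mem_cancel_right htD, A.add_mem_cancel_left ha,
      or_iff_left (by tauto)] at h
  have key : ∀ x ∈ B, x ∉ D → ∀ y ∈ D, y ∉ B → x + y ∈ A := by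
    intro x hxB hxD y hyD hyB
    have h := hcov (x + y)
    rwa [B.add_mem_cancel_left hxB, D.add_mem_cancel_right hyD,
      or_iff_left (by tauto)] at h
  refine AddSubgroup.index_eq_two_iff.mpr ⟨b, fun t => ?_⟩
  by_cases ht : t ∈ A
  · exact Or.inr ⟨ht, by rwa [A.add_mem_cancel_left ht]⟩
  refine Or.inl ⟨?_, ht⟩
  by_cases htB : t ∈ B
  · have htD : t ∉ D := fun h => ht (hBD t htB h)
    have h₁ := key t htB htD d hd hdB
    have h₂ := key b hb hbD (-d) (neg_mem hd) (by simpa using hdB)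
    simpa [add_add_add_comm] using add_mem h₁ h₂
  · have htD : t ∈ D := by have := hcov t; tauto
    simpa [add_comm] using key b hb hbD t htD htB

/-- An abelian group is not a union of two subgroups neither of which contains the other. -/
lemma false_of_union_two (hcov : ∀ v, v ∈ A ∨ v ∈ B) {a b : G} (haB : a ∉ B) (hbA : b ∉ A) :
    False := by
  have ha : a ∈ A := (hcov a).resolve_right haB
  have hb : b ∈ B := (hcov b).resolve_left hbA
  have h := hcov (a + b)
  rw [A.add_mem_cancel_left ha, B.add_mem_cancel_right hb] at h
  tauto

end Union

lemma mem_of_basis_mem {L : AddSubgroup Z2} (h₁ : ((1, 0) : Z2) ∈ L) (h₂ : ((0, 1) : Z2) ∈ L)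
    (v : Z2) : v ∈ L := by
  have h := add_mem (zsmul_mem h₁ v.1) (zsmul_mem h₂ v.2)
  simpa using h

lemma not_basis_mem_of_index_two {L : AddSubgroup Z2} (hL : L.index = 2) :
    ¬ (((1, 0) : Z2) ∈ L ∧ ((0, 1) : Z2) ∈ L) := by
  rintro ⟨h₁, h₂⟩
  have : L = ⊤ := (AddSubgroup.eq_top_iff' L).mpr (mem_of_basis_mem h₁ h₂)
  simp [this] at hL

/-- An index-two subgroup of `ℤ²` is determined by which basis vectors it contains. -/
lemma eq_of_index_two {L M : AddSubgroup Z2} (hL : L.index = 2) (hM : M.index = 2)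
    (h₁ : ((1, 0) : Z2) ∈ L ↔ (1, 0) ∈ M) (h₂ : ((0, 1) : Z2) ∈ L ↔ (0, 1) ∈ M) : L = M := by
  let S : AddSubgroup Z2 :=
    { carrier := {v | v ∈ L ↔ v ∈ M}
      zero_mem' := by simp
      add_mem' := fun {x y} hx hy => by
        simp only [Set.mem_ofPred_eq] at hx hy ⊢
        rw [AddSubgroup.add_mem_iff_of_index_two hL, AddSubgroup.add_mem_iff_of_index_two hM,
          hx, hy]
      neg_mem' := by simp }
  ext v
  exact mem_of_basis_mem (L := S) h₁ h₂ v

/-- There is no minimal covering of `ℤ²` of size 2, and every minimal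
covering of size 3 consists exactly of the three index-2 subgroups of `ℤ²`. -/
theorem minimal_coverings_size_two_three :
    (¬ ∃ C : Finset (AddSubgroup Z2), MinimalCovering C ∧ C.card = 2) ∧
    (∀ C : Finset (AddSubgroup Z2), MinimalCovering C → C.card = 3 →
      ∀ L : AddSubgroup Z2, L ∈ C ↔ L.index = 2) := by
  constructor
  · rintro ⟨C, hC, hcard⟩
    obtain ⟨A, B, hAB, rfl⟩ := Finset.card_eq_two.mp hcard
    obtain ⟨a, ha⟩ := hC.exists_forall_notMem (L := A) (by simp)
    obtain ⟨b, hb⟩ := hC.exists_forall_notMem (L := B) (by simp)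
    exact false_of_union_two (fun v => by simpa using hC.1.2 v)
      (ha B (by simp) hAB.symm) (hb A (by simp) hAB)
  · intro C hC hcard L
    obtain ⟨A, B, D, hAB, hAD, hBD, rfl⟩ := Finset.card_eq_three.mp hcard
    obtain ⟨a, ha⟩ := hC.exists_forall_notMem (L := A) (by simp)
    obtain ⟨b, hb⟩ := hC.exists_forall_notMem (L := B) (by simp)
    obtain ⟨d, hd⟩ := hC.exists_forall_notMem (L := D) (by simp)
    have haB := ha B (by simp) hAB.symm
    have haD := ha D (by simp) hAD.symm
    have hbA := hb A (by simp) hAB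
    have hbD := hb D (by simp) hBD.symm
    have hdA := hd A (by simp) hAD
    have hdB := hd B (by simp) hBD
    have hcov : ∀ v, v ∈ A ∨ v ∈ B ∨ v ∈ D := fun v => by simpa using hC.1.2 v
    have hA : A.index = 2 := index_eq_two_of_union_three hcov haB haD hbA hbD hdA hdB
    have hB : B.index = 2 := index_eq_two_of_union_three
      (fun v => by have := hcov v; tauto) hbA hbD haB haD hdB hdA
    have hD : D.index = 2 := index_eq_two_of_union_three
      (fun v => by have := hcov v; tauto) hdA hdB haD haB hbD hbA
    simp only [Finset.mem_insert, Finset.mem_singleton]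
    refine ⟨by rintro (rfl | rfl | rfl) <;> assumption, fun hL => ?_⟩
    have := not_basis_mem_of_index_two hA
    have := not_basis_mem_of_index_two hB
    have := not_basis_mem_of_index_two hD
    have := not_basis_mem_of_index_two hL
    grind [eq_of_index_two]
end

section
/- For each positive integer n, there are only finitely many irredundant coverings of ℤ² of size n. -/
/-- A covering is irredundant if no member is contained in the union of the others,
i.e. each member contains a vector lying in no other member. -/
def Irredundant (C : Finset (AddSubgroup Z2)) : Prop :=
  ∀ L ∈ C, ∃ v ∈ L, ∀ L' ∈ C, L' ≠ L → v ∉ L'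

open scoped Pointwise in
/-- If `v` lies in no member of `S`, then the translates by `v` of elements of `⨅ S` are covered by
the remaining members, so one of these meets `⨅ S` in a subgroup of small relative index. -/
theorem exists_relIndex_le_card_of_cover {G : Type*} [AddGroup G]
    {C S : Finset (AddSubgroup G)} (hcover : ∀ v : G, ∃ L ∈ C, v ∈ L)
    {v : G} (hv : ∀ L ∈ S, v ∉ L) :
    ∃ L ∈ C, L ∉ S ∧ L.relIndex (S.inf id) ≠ 0 ∧ L.relIndex (S.inf id) ≤ C.card := by
  classical
  set K := S.inf id
  have hK : ∀ L ∈ S, K ≤ L := fun L hL => Finset.inf_le (f := id) hL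
  let T := {L ∈ C | ∃ k : K, v + k ∈ L}
  let g : AddSubgroup G → K := fun L => if h : ∃ k : K, v + k ∈ L then h.choose else 0
  have hg : ∀ L, (∃ k : K, v + k ∈ L) → v + g L ∈ L := fun L h => by
    simpa only [g, dif_pos h] using h.choose_spec
  have hcov : ⋃ L ∈ T, g L +ᵥ ((L.addSubgroupOf K : AddSubgroup K) : Set K) = Set.univ := by
    refine Set.eq_univ_of_forall fun k => ?_
    obtain ⟨L, hL, hkL⟩ := hcover (v + k)
    refine Set.mem_biUnion (x := L) (by simpa [T] using ⟨hL, k, k.2, hkL⟩) ?_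
    rw [Set.mem_vadd_set_iff_neg_vadd_mem, SetLike.mem_coe, AddSubgroup.mem_addSubgroupOf]
    simpa [neg_add_rev, add_assoc] using L.add_mem (L.neg_mem (hg L ⟨k, hkL⟩)) hkL
  obtain ⟨L, hL, hfin, hle⟩ := AddSubgroup.exists_index_le_card_of_leftCoset_cover hcov
  obtain ⟨hLC, k, hk⟩ := Finset.mem_filter.1 hL
  refine ⟨L, hLC, fun hLS => hv L hLS ?_, hfin.index_ne_zero,
    hle.trans (Finset.card_filter_le _ _)⟩
  simpa using L.sub_mem hk (hK L hLS k.2)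

/-- Some `k` members of an irredundant covering of size `n` have intersection of index at
most `n ^ k`. -/
theorem exists_subset_card_eq_index_inf_le {C : Finset (AddSubgroup Z2)}
    (hcover : IsCovering C) (hirr : Irredundant C) (k : ℕ) (hk : k ≤ C.card) :
    ∃ S ⊆ C, S.card = k ∧ (S.inf id).index ≠ 0 ∧ (S.inf id).index ≤ C.card ^ k := by
  classical
  induction k with
  | zero => exact ⟨∅, by simp⟩
  | succ k ih =>
    obtain ⟨S, hSC, hcard, hne, hle⟩ := ih (by omega)
    obtain ⟨M, hM, hMS⟩ := Finset.exists_mem_notMem_of_card_lt_card (by omega : S.card < C.card)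
    obtain ⟨v, -, hv⟩ := hirr M hM
    obtain ⟨L, hL, hLS, hLne, hLle⟩ := exists_relIndex_le_card_of_cover hcover.2
      (fun L hL => hv L (hSC hL) (ne_of_mem_of_not_mem hL hMS))
    have hindex : ((insert L S).inf id).index = L.relIndex (S.inf id) * (S.inf id).index := by
      rw [Finset.inf_insert, id, ← AddSubgroup.inf_relIndex_right,
        AddSubgroup.relIndex_mul_index inf_le_right]
    refine ⟨insert L S, Finset.insert_subset hL hSC, by simp [hLS, hcard], ?_, ?_⟩
    · rw [hindex]
      exact mul_ne_zero hLne hne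
    · rw [hindex, pow_succ']
      exact Nat.mul_le_mul hLle hle

theorem index_le_of_mem_irredundant_covering {C : Finset (AddSubgroup Z2)}
    (hcover : IsCovering C) (hirr : Irredundant C) {L : AddSubgroup Z2} (hL : L ∈ C) :
    L.index ≤ C.card ^ C.card := by
  obtain ⟨S, hSC, hcard, hne, hle⟩ := exists_subset_card_eq_index_inf_le hcover hirr _ le_rfl
  obtain rfl := Finset.eq_of_subset_of_card_le hSC hcard.ge
  exact (Nat.le_of_dvd (Nat.pos_of_ne_zero hne)
    (AddSubgroup.index_dvd_of_le (Finset.inf_le (f := id) hL))).trans hle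

/-- A sublattice containing `N • ℤ²` is determined by its points in the box `[0, N)²`. -/
theorem finite_setOf_forall_nsmul_mem {N : ℕ} (hN : 0 < N) :
    {L : AddSubgroup Z2 | ∀ v : Z2, N • v ∈ L}.Finite := by
  let B : Set Z2 := Set.Ico 0 (N : ℤ) ×ˢ Set.Ico 0 (N : ℤ)
  have hB : B.Finite := (Set.finite_Ico _ _).prod (Set.finite_Ico _ _)
  have hN' : (0 : ℤ) < N := by exact_mod_cast hN
  refine Set.Finite.of_finite_image (f := fun L => (L : Set Z2) ∩ B)
    (hB.finite_subsets.subset ?_) ?_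
  · rintro _ ⟨L, -, rfl⟩
    exact Set.inter_subset_right
  · intro L hL M hM h
    have hmod (v : Z2) : v = (v.1 % N, v.2 % N) + N • (v.1 / N, v.2 / N) := by
      ext <;> simp [Int.emod_add_mul_ediv]
    have hbox (v : Z2) : ((v.1 % N, v.2 % N) : Z2) ∈ B :=
      ⟨⟨Int.emod_nonneg _ hN'.ne', Int.emod_lt_of_pos _ hN'⟩,
        ⟨Int.emod_nonneg _ hN'.ne', Int.emod_lt_of_pos _ hN'⟩⟩
    ext v
    have hv := Set.ext_iff.1 h (v.1 % N, v.2 % N)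
    simp only [Set.mem_inter_iff, hbox v, and_true, SetLike.mem_coe] at hv
    rw [hmod v, AddSubgroup.add_mem_cancel_right _ (hL _),
      AddSubgroup.add_mem_cancel_right _ (hM _), hv]

theorem finite_setOf_index_le (m : ℕ) :
    {L : AddSubgroup Z2 | L.index ≠ 0 ∧ L.index ≤ m}.Finite := by
  refine (finite_setOf_forall_nsmul_mem m.factorial_pos).subset ?_
  rintro L ⟨hne, hle⟩ v
  obtain ⟨c, hc⟩ := Nat.dvd_factorial (Nat.pos_of_ne_zero hne) hle
  rw [hc, mul_comm, mul_nsmul']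
  exact L.nsmul_mem (L.nsmul_index_mem v) c

/-- For each `n ≥ 1`, there are only finitely many irredundant coverings
of `ℤ²` of size `n`. -/
theorem finitely_many_irredundant_coverings (n : ℕ) (hn : 0 < n) :
    {C : Finset (AddSubgroup Z2) | IsCovering C ∧ Irredundant C ∧ C.card = n}.Finite := by
  have hfin := finite_setOf_index_le (n ^ n)
  refine hfin.toFinset.powerset.finite_toSet.subset ?_
  rintro C ⟨hcover, hirr, rfl⟩
  rw [Finset.mem_coe, Finset.mem_powerset]
  exact fun L hL => hfin.mem_toFinset.2
    ⟨hcover.1 L hL, index_le_of_mem_irredundant_covering hcover hirr hL⟩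
end

section
/- Let 𝒞 be an irredundant covering of ℤ², let p be a prime, and suppose the p-adic valuation of the least common multiple of the indices of the lattices in 𝒞 equals e ≥ 1. Then the number of lattices L ∈ 𝒞 with p^e ∣ [ℤ² : L] is at least p when e ≥ 2, and at least p + 1 when e = 1. -/
open Classical

open scoped Pointwise

section Covers

variable {G ι : Type*} [AddCommGroup G]

/-- The subgroup of all `x` such that `n • x ∈ H`. -/
def zsmulComap (n : ℤ) (H : AddSubgroup G) : AddSubgroup G :=
  H.comap (zsmulAddGroupHom n)

lemma mem_zsmulComap {n : ℤ} {H : AddSubgroup G} {x : G} :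
    x ∈ zsmulComap n H ↔ n • x ∈ H := Iff.rfl

lemma index_zsmulComap_ne_zero (n : ℤ) {H : AddSubgroup G} (hH : H.index ≠ 0) :
    (zsmulComap n H).index ≠ 0 := by
  have h : (zsmulComap n H).index ∣ H.index := by
    rw [zsmulComap, AddSubgroup.index_comap]
    exact AddSubgroup.relIndex_dvd_index_of_normal _ _
  exact fun h0 => hH (Nat.eq_zero_of_zero_dvd (h0 ▸ h))

lemma zsmul_mem_of_index_dvd {H : AddSubgroup G} {n : ℤ} (h : (H.index : ℤ) ∣ n) (x : G) :
    n • x ∈ H := by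
  obtain ⟨k, rfl⟩ := h
  rw [mul_comm, mul_zsmul, natCast_zsmul]
  exact H.zsmul_mem (AddSubgroup.nsmul_index_mem H x) k

/-- A prime dividing the index of `H` divides every exponent of the quotient by `H`. -/
lemma prime_dvd_of_dvd_index {H : AddSubgroup G} (hH : H.index ≠ 0) {q : ℕ} (hq : q.Prime)
    (hqH : q ∣ H.index) {n : ℤ} (hn : ∀ x : G, n • x ∈ H) : (q : ℤ) ∣ n := by
  have : H.FiniteIndex := ⟨hH⟩
  have := Fact.mk hq
  obtain ⟨x, hx⟩ := exists_prime_addOrderOf_dvd_card' (G := G ⧸ H) q hqH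
  rw [← hx, addOrderOf_dvd_iff_zsmul_eq_zero]
  obtain ⟨y, rfl⟩ := QuotientAddGroup.mk_surjective x
  rw [← QuotientAddGroup.mk_zsmul, QuotientAddGroup.eq_zero_iff]
  exact hn y

lemma index_dvd_index_zsmulComap_mul {a b : ℤ} (hab : a + b = 1) (H : AddSubgroup G) :
    H.index ∣ (zsmulComap a H).index * (zsmulComap b H).index := by
  have hle : zsmulComap a H ⊓ zsmulComap b H ≤ H := fun x hx => by
    rw [← one_zsmul x, ← hab, add_zsmul]
    exact H.add_mem hx.1 hx.2
  refine (AddSubgroup.index_dvd_of_le hle).trans ?_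
  rw [← AddSubgroup.relIndex_mul_index inf_le_right, AddSubgroup.inf_relIndex_right]
  exact mul_dvd_mul_right (AddSubgroup.relIndex_dvd_index_of_normal _ _) _

/-- A group covered by subgroups of indices at least `n` needs more than `n` of them. -/
lemma lt_card_of_subgroup_cover {n : ℕ} (hn : 2 ≤ n) {s : Finset ι} {H : ι → AddSubgroup G}
    (hcover : ∀ x, ∃ i ∈ s, x ∈ H i) (hfin : ∀ i ∈ s, (H i).index ≠ 0)
    (hindex : ∀ i ∈ s, n ≤ (H i).index) : n < s.card := by
  have hcover' : ⋃ i ∈ s, (0 : G) +ᵥ (H i : Set G) = Set.univ := by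
    simpa [Set.eq_univ_iff_forall] using hcover
  have hnQ : (0 : ℚ) < n := by exact_mod_cast (by omega : 0 < n)
  by_contra! hcard
  have hsum : ∑ i ∈ s, ((H i).index : ℚ)⁻¹ ≤ s.card * (n : ℚ)⁻¹ := by
    rw [← nsmul_eq_mul]
    refine Finset.sum_le_card_nsmul _ _ _ fun i hi => ?_
    exact inv_anti₀ hnQ (by exact_mod_cast hindex i hi)
  have hone := AddSubgroup.one_le_sum_inv_index_of_leftCoset_cover hcover'
  have hle : (s.card : ℚ) * (n : ℚ)⁻¹ ≤ 1 := by
    rw [← div_eq_mul_inv, div_le_one hnQ]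
    exact_mod_cast hcard
  have hn_le : (n : ℚ) ≤ s.card := by
    rw [← one_le_div hnQ, div_eq_mul_inv]
    exact hone.trans hsum
  have hn_le' : n ≤ s.card := by exact_mod_cast hn_le
  have hdisj := AddSubgroup.pairwiseDisjoint_leftCoset_cover_of_sum_neg_index_eq_zero hcover'
    (le_antisymm (hsum.trans hle) hone)
  obtain ⟨i, hi, j, hj, hij⟩ := Finset.one_lt_card.1 (by omega : 1 < s.card)
  have hmem : ∀ k ∈ s, k ∈ (s.filter fun i => (H i).FiniteIndex : Set ι) := fun k hk => by
    simpa using ⟨hk, ⟨hfin k hk⟩⟩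
  have hzero : ∀ k, (0 : G) ∈ (0 : G) +ᵥ (H k : Set G) := by simp
  exact Set.disjoint_left.1 (hdisj (hmem i hi) (hmem j hj) hij) (hzero i) (hzero j)

end Covers

lemma exists_zsmul_isCoprime (v : Z2) :
    ∃ (d : ℤ) (x : Z2), IsCoprime x.1 x.2 ∧ v = d • x := by
  by_cases h : Int.gcd v.1 v.2 = 0
  · rw [Int.gcd_eq_zero_iff] at h
    exact ⟨0, (1, 0), isCoprime_one_left, by ext <;> simp [h]⟩
  · obtain ⟨a, b, hab, h1, h2⟩ := Int.exists_gcd_one (Nat.pos_of_ne_zero h)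
    refine ⟨Int.gcd v.1 v.2, (a, b), Int.isCoprime_iff_gcd_eq_one.2 hab, ?_⟩
    ext
    · simpa [mul_comm] using h1
    · simpa [mul_comm] using h2

/-- If `H` contains a primitive vector, then the quotient by `H` is cyclic, so its order divides
every exponent. -/
lemma index_dvd_of_isCoprime_mem {H : AddSubgroup Z2} {x : Z2} (hx : IsCoprime x.1 x.2)
    (hxH : x ∈ H) {n : ℕ} (hn : ∀ w : Z2, (n : ℤ) • w ∈ H) : H.index ∣ n := by
  obtain ⟨a, b, hab⟩ := hx
  let φ : Z2 →+ ℤ :=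
    { toFun := fun w => x.1 * w.2 - x.2 * w.1
      map_zero' := by simp
      map_add' := fun u w => by simp only [Prod.fst_add, Prod.snd_add]; ring }
  have hφ : ∀ w : Z2, φ w = x.1 * w.2 - x.2 * w.1 := fun _ => rfl
  have hsurj : Function.Surjective φ := fun t =>
    ⟨(-(t * b), t * a), by rw [hφ]; linear_combination t * hab⟩
  have hle : (AddSubgroup.zmultiples (n : ℤ)).comap φ ≤ H := by
    intro w hw
    obtain ⟨t, ht⟩ := AddSubgroup.mem_zmultiples_iff.1 hw
    rw [smul_eq_mul, hφ] at ht
    have hw' : w = (a * w.1 + b * w.2) • x + (n : ℤ) • ((-(t * b), t * a) : Z2) := by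
      ext
      · simp only [Prod.fst_add, Prod.smul_fst, smul_eq_mul]
        linear_combination (-w.1) * hab + b * ht
      · simp only [Prod.snd_add, Prod.smul_snd, smul_eq_mul]
        linear_combination (-w.2) * hab - a * ht
    rw [hw']
    exact H.add_mem (H.zsmul_mem hxH _) (hn _)
  have h := AddSubgroup.index_dvd_of_le hle
  rwa [AddSubgroup.index_comap_of_surjective _ hsurj, Int.index_zmultiples, Int.natAbs_natCast] at h

/-- The bound for coverings of `ℤ²` by subgroups whose quotients are `p`-groups. -/
lemma card_bound_of_prime_pow_cover {ι : Type*} {p : ℕ} (hp : p.Prime) (k : ℕ) {T : Finset ι}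
    {H : ι → AddSubgroup Z2} (A : ι → Prop)
    [DecidablePred A] (hcover : ∀ u, ∃ i ∈ T, u ∈ H i)
    (hfin : ∀ i ∈ T, (H i).index ≠ 0)
    (hexp : ∀ i ∈ T, ∀ w : Z2, ((p ^ (k + 1) : ℕ) : ℤ) • w ∈ H i)
    (hbig : ∀ i ∈ T, A i → p ^ (k + 1) ∣ (H i).index)
    (hsmall : ∀ i ∈ T, ¬ A i → ∀ w : Z2, ((p ^ k : ℕ) : ℤ) • w ∈ H i)
    {v : Z2} (hv : ∀ i ∈ T, ¬ A i → v ∉ H i) :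
    (k ≠ 0 → p ≤ (T.filter A).card) ∧ (k = 0 → p < (T.filter A).card) := by
  refine ⟨fun hk => ?_, ?_⟩
  · obtain ⟨d, x, hx, rfl⟩ := exists_zsmul_isCoprime v
    have hcov : ∀ w : Z2, ∃ i ∈ T.filter A, x + ((p ^ k : ℕ) : ℤ) • w ∈ H i := by
      intro w
      obtain ⟨i, hi, hmem⟩ := hcover (x + ((p ^ k : ℕ) : ℤ) • w)
      refine ⟨i, Finset.mem_filter.2 ⟨hi, ?_⟩, hmem⟩
      by_contra hA
      exact hv i hi hA ((H i).zsmul_mem (((H i).add_mem_cancel_right (hsmall i hi hA w)).1 hmem) d)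
    let s := (T.filter A).filter fun i => ∃ w : Z2, x + ((p ^ k : ℕ) : ℤ) • w ∈ H i
    have hs : ∀ i, ∃ w : Z2, i ∈ s → x + ((p ^ k : ℕ) : ℤ) • w ∈ H i := by
      intro i
      by_cases hi : i ∈ s
      · obtain ⟨w, hw⟩ := (Finset.mem_filter.1 hi).2
        exact ⟨w, fun _ => hw⟩
      · exact ⟨0, fun h => absurd h hi⟩
    choose g hg using hs
    have hcover' : ⋃ i ∈ s, g i +ᵥ (zsmulComap ((p ^ k : ℕ) : ℤ) (H i) : Set Z2) = Set.univ := by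
      refine Set.eq_univ_of_forall fun w => ?_
      obtain ⟨i, hi, hw⟩ := hcov w
      have his : i ∈ s := Finset.mem_filter.2 ⟨hi, w, hw⟩
      refine Set.mem_iUnion₂.2 ⟨i, his, ?_⟩
      rw [mem_leftAddCoset_iff, SetLike.mem_coe, mem_zsmulComap, zsmul_add, zsmul_neg]
      convert (H i).sub_mem hw (hg i his) using 1
      abel
    obtain ⟨i, hi, -, hle⟩ := AddSubgroup.exists_index_le_card_of_leftCoset_cover hcover'
    refine le_trans ?_ (hle.trans (Finset.card_le_card (Finset.filter_subset _ _)))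
    obtain ⟨hiT, hA⟩ := Finset.mem_filter.1 (Finset.mem_filter.1 hi).1
    have hne := index_zsmulComap_ne_zero ((p ^ k : ℕ) : ℤ) (hfin i hiT)
    have hne_one : (zsmulComap ((p ^ k : ℕ) : ℤ) (H i)).index ≠ 1 := by
      intro h1
      have hall : ∀ w : Z2, ((p ^ k : ℕ) : ℤ) • w ∈ H i := fun w => by
        rw [← mem_zsmulComap, AddSubgroup.index_eq_one.1 h1]
        trivial
      have hxi : x ∈ H i := ((H i).add_mem_cancel_right (hall _)).1 (hg i hi)
      have hdvd := (hbig i hiT hA).trans (index_dvd_of_isCoprime_mem hx hxi hall)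
      exact absurd ((Nat.pow_dvd_pow_iff_le_right hp.one_lt).1 hdvd) (by omega)
    obtain ⟨q, hq, hqi⟩ := Nat.exists_prime_and_dvd hne_one
    have hqp : (q : ℤ) ∣ p := prime_dvd_of_dvd_index hne hq hqi fun w => by
      rw [mem_zsmulComap, smul_smul]
      convert hexp i hiT w using 2
      push_cast
      ring
    rw [Int.natCast_dvd_natCast, Nat.prime_dvd_prime_iff_eq hq hp] at hqp
    exact hqp.symm.le.trans (Nat.le_of_dvd (Nat.pos_of_ne_zero hne) hqi)
  · rintro rfl
    refine lt_card_of_subgroup_cover hp.two_le (H := H) (fun u => ?_)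
      (fun i hi => hfin i (Finset.mem_filter.1 hi).1) fun i hi => ?_
    · obtain ⟨i, hi, hu⟩ := hcover u
      refine ⟨i, Finset.mem_filter.2 ⟨hi, ?_⟩, hu⟩
      by_contra hA
      exact hv i hi hA (by simpa using hsmall i hi hA v)
    · obtain ⟨hiT, hA⟩ := Finset.mem_filter.1 hi
      exact Nat.le_of_dvd (Nat.pos_of_ne_zero (hfin i hiT)) (by simpa using hbig i hiT hA)

lemma dvd_prime_pow_mul_of_not_pow_dvd {p k m d : ℕ} (hp : p.Prime) (hd : d ∣ p ^ (k + 1) * m)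
    (hpd : ¬ p ^ (k + 1) ∣ d) : d ∣ p ^ k * m := by
  obtain ⟨a, b, ha, hb, rfl⟩ := (Nat.dvd_mul).1 hd
  obtain ⟨j, hj, rfl⟩ := (Nat.dvd_prime_pow hp).1 ha
  refine mul_dvd_mul (pow_dvd_pow p ?_) hb
  by_contra! hlt
  exact hpd ((pow_dvd_pow p hlt).mul_right b)

/-- If `C` is an irredundant covering of `ℤ²` and `p^e` exactly divides
the lcm of the indices (`e ≥ 1`), then the number of members of `C` whose index is
divisible by `p^e` is at least `p` when `e ≥ 2` and at least `p + 1` when `e = 1`. -/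
theorem max_p_valuation_multiplicity (C : Finset (AddSubgroup Z2))
    (hcov : IsCovering C) (hirr : Irredundant C)
    (p : ℕ) (hp : p.Prime) (e : ℕ) (he : 1 ≤ e)
    (hval : (C.lcm fun L => L.index).factorization p = e) :
    (2 ≤ e → p ≤ (C.filter fun L => p ^ e ∣ L.index).card) ∧
    (e = 1 → p + 1 ≤ (C.filter fun L => p ^ e ∣ L.index).card) := by
  obtain ⟨k, rfl⟩ : ∃ k, e = k + 1 := ⟨e - 1, by omega⟩
  obtain ⟨hfin, hcover⟩ := hcov
  have hN0 : (C.lcm fun L => L.index) ≠ 0 := by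
    rw [Ne, Finset.lcm_eq_zero_iff]
    rintro ⟨L, hL, h0⟩
    exact hfin L hL h0
  obtain ⟨m, hN, hpm⟩ : ∃ m, (C.lcm fun L => L.index) = p ^ (k + 1) * m ∧ ¬ p ∣ m :=
    ⟨_, by rw [← hval, Nat.ordProj_mul_ordCompl_eq_self], Nat.not_dvd_ordCompl hp hN0⟩
  have hdvd : ∀ L ∈ C, L.index ∣ p ^ (k + 1) * m := fun L hL => hN ▸ Finset.dvd_lcm hL
  obtain ⟨L₀, hL₀, hpL₀⟩ : ∃ L ∈ C, p ^ (k + 1) ∣ L.index := by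
    by_contra! h
    have h1 : (C.lcm fun L => L.index) ∣ p ^ k * m :=
      Finset.lcm_dvd fun L hL => dvd_prime_pow_mul_of_not_pow_dvd hp (hdvd L hL) (h L hL)
    rw [hN, pow_succ, mul_assoc] at h1
    have h2 := Nat.dvd_of_mul_dvd_mul_left (pow_pos hp.pos k) h1
    have hm : 0 < m := Nat.pos_of_ne_zero fun h0 => hpm (h0 ▸ dvd_zero p)
    exact hpm ((Nat.mul_dvd_mul_iff_right hm (a := p) (b := 1)).1 (by simpa using h2) |>.trans
      (one_dvd m))
  obtain ⟨v, -, hv⟩ := hirr L₀ hL₀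
  have hcop : IsCoprime (m : ℤ) ((p ^ (k + 1) : ℕ) : ℤ) :=
    Nat.isCoprime_iff_coprime.2 (((hp.coprime_iff_not_dvd.2 hpm).pow_left _).symm)
  obtain ⟨a, b, hab⟩ := hcop
  set α : ℤ := a * m with hα
  set β : ℤ := b * (p ^ (k + 1) : ℕ) with hβ
  let T := C.filter fun L => β • v ∈ L
  have hTC : ∀ L ∈ T, L ∈ C := fun L hL => (Finset.mem_filter.1 hL).1
  have hαmem : ∀ L ∈ C, ∀ w : Z2, (α * (p ^ (k + 1) : ℕ)) • w ∈ L := fun L hL =>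
    zsmul_mem_of_index_dvd <| (Int.natCast_dvd_natCast.2 (hdvd L hL)).trans
      ⟨a, by rw [hα]; push_cast; ring⟩
  have key := card_bound_of_prime_pow_cover hp k (T := T) (H := zsmulComap α)
    (fun L => p ^ (k + 1) ∣ L.index) (v := v) ?_ ?_ ?_ ?_ ?_ ?_
  · have hcard : (T.filter fun L => p ^ (k + 1) ∣ L.index).card ≤
        (C.filter fun L => p ^ (k + 1) ∣ L.index).card :=
      Finset.card_le_card (Finset.filter_subset_filter _ (Finset.filter_subset _ _))
    exact ⟨fun h => (key.1 (by omega)).trans hcard,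
      fun h => (Nat.succ_le_of_lt (key.2 (by omega))).trans hcard⟩
  · intro u
    obtain ⟨L, hL, hu⟩ := hcover (α • u + β • v)
    have hαu : α • u ∈ L := by
      have h1 := L.add_mem (L.zsmul_mem hu α) (hαmem L hL (b • (u - v)))
      convert h1 using 1
      rw [← sub_eq_zero]
      have hα1 : α = 1 - β := by linear_combination hab
      rw [smul_smul, mul_assoc, mul_comm _ b, ← hβ, smul_add, smul_smul, smul_smul, smul_sub]
      have hsq : α = α * α + α * β := by linear_combination (-α) * hab
      nth_rewrite 1 [hsq]
      rw [add_smul]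
      abel
    exact ⟨L, Finset.mem_filter.2 ⟨hL, (L.add_mem_cancel_left hαu).1 hu⟩, hαu⟩
  · exact fun L hL => index_zsmulComap_ne_zero α (hfin L (hTC L hL))
  · intro L hL w
    rw [mem_zsmulComap, smul_smul]
    exact hαmem L (hTC L hL) w
  · intro L hL hpL
    have hcop' : (p ^ (k + 1)).Coprime (zsmulComap β L).index := by
      refine Nat.Coprime.pow_left _ ((Nat.Prime.coprime_iff_not_dvd hp).2 fun hdiv => hpm ?_)
      refine Int.natCast_dvd_natCast.1 (prime_dvd_of_dvd_index
        (index_zsmulComap_ne_zero β (hfin L (hTC L hL))) hp hdiv fun w => ?_)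
      rw [mem_zsmulComap, smul_smul]
      refine zsmul_mem_of_index_dvd ((Int.natCast_dvd_natCast.2 (hdvd L (hTC L hL))).trans
        ⟨b, ?_⟩) w
      rw [hβ]
      push_cast
      ring
    exact hcop'.dvd_of_dvd_mul_right (hpL.trans (index_dvd_index_zsmulComap_mul hab L))
  · intro L hL hpL w
    rw [mem_zsmulComap, smul_smul]
    refine zsmul_mem_of_index_dvd ((Int.natCast_dvd_natCast.2
      (dvd_prime_pow_mul_of_not_pow_dvd hp (hdvd L (hTC L hL)) hpL)).trans ⟨a, ?_⟩) w
    rw [hα]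
    push_cast
    ring
  · intro L hL hpL hvL
    refine hv L (hTC L hL) (fun h => hpL (h ▸ hpL₀)) ?_
    rw [← one_zsmul v, ← hab, add_zsmul]
    exact L.add_mem hvL (Finset.mem_filter.1 hL).2
end

section
/- Let 𝒞 be an irredundant covering of ℤ², let p be a prime, and suppose some lattice L ∈ 𝒞 has index [ℤ² : L] with p-adic valuation e ≥ 1. Then the size of 𝒞 is at least e(p − 1) + 2. -/
/-- If an integral combination of characters of a finite abelian group vanishes outside a
subgroup `K`, then on `K` it is `K.index` times an integral combination of characters. -/
theorem exists_sum_char_eq_index_mul {G : Type*} [AddCommGroup G] [Finite G] (K : AddSubgroup G)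
    [Fintype (AddChar G ℂ)] (a : AddChar G ℂ → ℤ)
    (ha : ∀ g ∉ K, ∑ θ, (a θ : ℂ) * θ g = 0) :
    ∃ s : Finset (AddChar G ℂ), ∀ g ∈ K,
      ∑ θ, (a θ : ℂ) * θ g = K.index * ∑ θ ∈ s, (a θ : ℂ) * θ g := by
  classical
  let f : AddChar (G ⧸ K) ℂ →* AddChar G ℂ :=
    { toFun := fun ψ => ψ.compAddMonoidHom (QuotientAddGroup.mk' K)
      map_one' := rfl
      map_mul' := fun _ _ => rfl }
  have hf : Function.Injective f :=
    AddChar.compAddMonoidHom_injective_left _ (QuotientAddGroup.mk'_surjective K)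
  have hcard : Nat.card f.range = K.index := by
    rw [← Nat.card_congr (MonoidHom.ofInjective hf).toEquiv]
    have := Fintype.ofFinite (G ⧸ K)
    rw [Nat.card_eq_fintype_card, AddChar.card_eq, ← Nat.card_eq_fintype_card]
    rfl
  have hone : ∀ ψ ∈ f.range, ∀ g ∈ K, ψ g = 1 := by
    rintro _ ⟨ψ, rfl⟩ g hg
    change ψ (g : G ⧸ K) = 1
    rw [(QuotientAddGroup.eq_zero_iff g).2 hg, AddChar.map_zero_eq_one]
  have hinv : ∀ ψ ∈ f.range, ∀ θ, a (θ * ψ) = a θ := by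
    intro ψ hψ
    have key : ∑ θ, (((a (θ * ψ) : ℂ)) - a θ) • (θ : G → ℂ) = 0 := by
      funext g
      have h1 : ∑ θ, (a (θ * ψ) : ℂ) * (θ * ψ) g = ∑ θ, (a θ : ℂ) * θ g :=
        Equiv.sum_comp (Equiv.mulRight ψ) fun θ => (a θ : ℂ) * θ g
      have hu : ψ g ≠ 0 := (ψ.val_isUnit g).ne_zero
      have h2 : ψ g * ∑ θ, (a (θ * ψ) : ℂ) * θ g = ∑ θ, (a θ : ℂ) * θ g := by
        rw [← h1, Finset.mul_sum]
        exact Finset.sum_congr rfl fun θ _ => by rw [AddChar.mul_apply]; ring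
      simp only [Finset.sum_apply, Pi.smul_apply, smul_eq_mul, sub_mul, Finset.sum_sub_distrib,
        Pi.zero_apply]
      by_cases hg : g ∈ K
      · rw [hone ψ hψ g hg, one_mul] at h2
        rw [h2, sub_self]
      · rw [ha g hg] at h2 ⊢
        simpa [hu] using h2
    intro θ
    have := Fintype.linearIndependent_iff.1 (AddChar.linearIndependent G ℂ) _ key θ
    exact_mod_cast sub_eq_zero.1 this
  let m : (AddChar G ℂ ⧸ f.range) × f.range → AddChar G ℂ := fun x => x.1.out * x.2
  have hm : Function.Bijective m := by
    constructor
    · rintro ⟨q, h⟩ ⟨q', h'⟩ hq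
      have hq' : q = q' := by
        have := congrArg (QuotientGroup.mk : _ → AddChar G ℂ ⧸ f.range) hq
        simpa [m] using this
      subst hq'
      simpa [m] using hq
    · intro θ
      obtain ⟨h, hh⟩ := QuotientGroup.mk_out_eq_mul f.range θ
      exact ⟨(θ, h⁻¹), by simp [m, hh]⟩
  refine ⟨Finset.univ.image (Quotient.out : AddChar G ℂ ⧸ f.range → _), fun g hg => ?_⟩
  rw [Finset.sum_image (Quotient.out_injective.injOn),
    ← (Equiv.ofBijective m hm).sum_comp, Fintype.sum_prod_type, Finset.mul_sum]
  refine Finset.sum_congr rfl fun q _ => ?_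
  rw [Finset.sum_congr rfl fun h _ => show _ = (a q.out : ℂ) * q.out g by
    simp [m, hinv _ h.2, hone _ h.2 g hg, AddChar.mul_apply]]
  rw [Finset.sum_const, Finset.card_univ, ← Nat.card_eq_fintype_card, hcard, nsmul_eq_mul]

theorem one_sub_pow_dvd_prime {R : Type*} [CommRing R] [IsDomain R] {p : ℕ} (hp : p.Prime)
    {s : ℕ} {ω : R} (hω : ω ^ p ^ s = 1) (hω1 : ω ≠ 1) : (1 - ω) ^ (p - 1) ∣ (p : R) := by
  obtain ⟨k, -, hk⟩ := (Nat.dvd_prime_pow hp).1 (orderOf_dvd_of_pow_eq_one hω)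
  obtain _ | k := k
  · exact absurd (orderOf_eq_one_iff.1 (by simpa using hk)) hω1
  have hprim : IsPrimitiveRoot (ω ^ p ^ k) p :=
    (IsPrimitiveRoot.orderOf ω).pow (by rw [hk]; exact pow_pos hp.pos _) (by rw [hk, pow_succ])
  obtain ⟨n, rfl⟩ : ∃ n, p = n + 1 := ⟨p - 1, by have := hp.pos; omega⟩
  have h := hprim.prod_one_sub_pow_eq_order
  rw [Nat.cast_add_one, ← h, show n + 1 - 1 = n from rfl]
  calc (1 - ω) ^ n = ∏ i ∈ Finset.range n, (1 - ω) := by simp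
    _ ∣ _ := Finset.prod_dvd_prod_of_dvd _ _ fun i _ => by
      rw [← pow_mul]
      exact one_sub_dvd_one_sub_pow _ _

theorem prime_dvd_sum_sub_one_pow {R : Type*} [CommRing R] {p : ℕ} (hp : p.Prime) (s : ℕ)
    {κ : Type*} (t : Finset κ) (a : κ → ℤ) (μ : κ → R) (hμ : ∀ i ∈ t, μ i ^ p ^ s = 1) :
    (p : R) ∣ (∑ i ∈ t, (a i : R) * (μ i - 1)) ^ p ^ s := by
  by_cases hu : (p : R) ∈ nonunits R
  · have := Fact.mk hp
    have := CharP.quotient R p hu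
    rw [← Ideal.mem_span_singleton, ← Ideal.Quotient.eq_zero_iff_mem, map_pow, map_sum,
      sum_pow_char_pow]
    refine Finset.sum_eq_zero fun i hi => ?_
    rw [map_mul, mul_pow, map_sub, sub_pow_char_pow, ← map_pow _ (μ i), hμ i hi]
    simp
  · exact (not_not.1 hu).dvd

theorem mul_pred_lt_card_of_prod_one_sub_eq {R : Type*} [CommRing R] [IsDomain R] {p : ℕ}
    (hp : p.Prime) (hp0 : (p : R) ≠ 0) (hu : ¬ IsUnit (p : R)) (s e : ℕ) {ι : Type*}
    (J : Finset ι) (ω : ι → R) (hω : ∀ j ∈ J, ω j ^ p ^ s = 1) (hω1 : ∀ j ∈ J, ω j ≠ 1) (B : R)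
    (hB : (p : R) ∣ B ^ p ^ s) (h : ∏ j ∈ J, (1 - ω j) = p ^ e * B) : e * (p - 1) < J.card := by
  by_contra! hle
  have h1 : (∏ j ∈ J, (1 - ω j)) ^ (p - 1) ∣ (p : R) ^ (e * (p - 1)) := by
    refine dvd_trans ?_ (pow_dvd_pow _ hle)
    rw [← Finset.prod_pow, ← Finset.prod_const]
    exact Finset.prod_dvd_prod_of_dvd _ _ fun j hj => one_sub_pow_dvd_prime hp (hω j hj) (hω1 j hj)
  rw [h, mul_pow, ← pow_mul] at h1
  have h2 : IsUnit (B ^ (p - 1)) := by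
    obtain ⟨c, hc⟩ := h1
    refine IsUnit.of_mul_eq_one c ?_
    refine mul_left_cancel₀ (pow_ne_zero (e * (p - 1)) hp0) ?_
    rw [← mul_assoc, ← hc, mul_one]
  have h3 : IsUnit B := (isUnit_pow_iff (by have := hp.two_le; omega)).1 h2
  exact hu (isUnit_of_dvd_unit hB (h3.pow _))

theorem not_isUnit_natCast_integralClosure {p : ℕ} (hp : p.Prime) :
    ¬ IsUnit (p : integralClosure ℤ ℂ) := by
  intro h
  obtain ⟨c, hc⟩ := h.exists_right_inv
  have hc' : (p : ℂ) * c = 1 := by exact_mod_cast congrArg Subtype.val hc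
  have hpc : (p : ℂ) ≠ 0 := by exact_mod_cast hp.ne_zero
  have hcq : (c : ℂ) = algebraMap ℚ ℂ ((p : ℚ)⁻¹) := by
    rw [map_inv₀, map_natCast]; exact eq_inv_of_mul_eq_one_right hc'
  have hint : IsIntegral ℤ ((p : ℚ)⁻¹) := by
    rw [← isIntegral_algebraMap_iff (B := ℂ) (algebraMap ℚ ℂ).injective, ← hcq]
    exact c.2
  obtain ⟨z, hz⟩ := IsIntegrallyClosed.isIntegral_iff.1 hint
  have hpq : (p : ℚ) ≠ 0 := by exact_mod_cast hp.ne_zero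
  have : (p : ℚ) * z = 1 := by
    rw [show (z : ℚ) = (p : ℚ)⁻¹ from hz, mul_inv_cancel₀ hpq]
  have hz1 : (p : ℤ) * z = 1 := by exact_mod_cast this
  exact (Nat.prime_iff_prime_int.1 hp).not_isUnit (IsUnit.of_mul_eq_one _ hz1)

theorem exists_prod_one_sub_char_eq_sum {G : Type*} [AddCommGroup G] [Fintype (AddChar G ℂ)]
    {ι : Type*} (J : Finset ι) (χ : ι → AddChar G ℂ) :
    ∃ a : AddChar G ℂ → ℤ, ∀ g, ∏ j ∈ J, (1 - χ j g) = ∑ θ, (a θ : ℂ) * θ g := by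
  classical
  induction J using Finset.induction_on with
  | empty => exact ⟨fun θ => if θ = 1 then 1 else 0, fun g => by simp⟩
  | insert j J hj ih =>
    obtain ⟨a, ha⟩ := ih
    refine ⟨fun θ => a θ - a ((χ j)⁻¹ * θ), fun g => ?_⟩
    have h : ∑ θ, (a ((χ j)⁻¹ * θ) : ℂ) * θ g = χ j g * ∑ θ, (a θ : ℂ) * θ g := by
      rw [← Equiv.sum_comp (Equiv.mulLeft (χ j)), Finset.mul_sum]
      refine Finset.sum_congr rfl fun θ _ => ?_
      simp only [Equiv.coe_mulLeft, inv_mul_cancel_left, AddChar.mul_apply]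
      ring
    simp only [Int.cast_sub, sub_mul, Finset.sum_sub_distrib]
    rw [Finset.prod_insert hj, ha, h, sub_mul, one_mul]

theorem exists_char_eq_one_on_ne_one {G : Type*} [AddCommGroup G] [Finite G] (S : AddSubgroup G)
    {y : G} (hy : y ∉ S) : ∃ χ : AddChar G ℂ, (∀ g ∈ S, χ g = 1) ∧ χ y ≠ 1 := by
  obtain ⟨ψ, hψ⟩ := AddChar.exists_apply_ne_zero.2
    (mt (QuotientAddGroup.eq_zero_iff y).1 hy : (y : G ⧸ S) ≠ 0)
  refine ⟨ψ.compAddMonoidHom (QuotientAddGroup.mk' S), fun g hg => ?_, hψ⟩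
  change ψ (g : G ⧸ S) = 1
  rw [(QuotientAddGroup.eq_zero_iff g).2 hg, AddChar.map_zero_eq_one]

/-- In a finite abelian `p`-group, at least `e * (p - 1) + 1` subgroups avoiding a given element
of `K` are needed to cover the complement of `K`, if `p ^ e` divides the index of `K`. -/
theorem mul_pred_lt_card_of_compl_cover {G : Type*} [AddCommGroup G] [Finite G] {p : ℕ}
    (hp : p.Prime) (s : ℕ) (hG : ∀ g : G, p ^ s • g = 0) (K : AddSubgroup G) {e : ℕ} (he : 1 ≤ e)
    (hK : p ^ e ∣ K.index) {ι : Type*} (J : Finset ι) (S : ι → AddSubgroup G) {y : G}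
    (hyK : y ∈ K) (hyS : ∀ j ∈ J, y ∉ S j) (hcov : ∀ g ∉ K, ∃ j ∈ J, g ∈ S j) :
    e * (p - 1) < J.card := by
  classical
  have := Fintype.ofFinite (AddChar G ℂ)
  have hχ : ∀ j, ∃ χ : AddChar G ℂ, j ∈ J → (∀ g ∈ S j, χ g = 1) ∧ χ y ≠ 1 := by
    intro j
    by_cases hj : j ∈ J
    · obtain ⟨χ, h⟩ := exists_char_eq_one_on_ne_one (S j) (hyS j hj)
      exact ⟨χ, fun _ => h⟩
    · exact ⟨1, fun h => absurd h hj⟩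
  choose χ hχ using hχ
  obtain ⟨a, ha⟩ := exists_prod_one_sub_char_eq_sum J χ
  obtain ⟨t, ht⟩ := exists_sum_char_eq_index_mul K a fun g hg => by
    obtain ⟨j, hj, hgj⟩ := hcov g hg
    rw [← ha]
    exact Finset.prod_eq_zero hj (by rw [(hχ j hj).1 g hgj, sub_self])
  have hroot : ∀ θ : AddChar G ℂ, θ y ^ p ^ s = 1 := fun θ => by
    rw [← AddChar.map_nsmul_eq_pow, hG, AddChar.map_zero_eq_one]
  have hKtop : K ≠ ⊤ := by
    rintro rfl
    rw [AddSubgroup.index_top, Nat.dvd_one] at hK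
    exact absurd hK (Nat.one_lt_pow (by omega) hp.one_lt).ne'
  obtain ⟨g, hg⟩ : ∃ g, g ∉ K := by
    by_contra! h
    exact hKtop ((AddSubgroup.eq_top_iff' K).2 h)
  obtain ⟨j₀, hj₀, -⟩ := hcov g hg
  have hzero : ∑ θ ∈ t, (a θ : ℂ) = 0 := by
    have h := ht 0 K.zero_mem
    rw [← ha, Finset.prod_eq_zero hj₀ (by simp)] at h
    have hK0 : (K.index : ℂ) ≠ 0 := by exact_mod_cast AddSubgroup.FiniteIndex.index_ne_zero
    simpa [hK0] using h.symm
  obtain ⟨n, hn⟩ := hK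
  let μ : AddChar G ℂ → integralClosure ℤ ℂ := fun θ =>
    ⟨θ y, IsIntegral.of_pow (pow_pos hp.pos s) (by rw [hroot]; exact isIntegral_one)⟩
  have hμ : ∀ θ, μ θ ^ p ^ s = 1 := fun θ => Subtype.ext (by simpa [μ] using hroot θ)
  refine mul_pred_lt_card_of_prod_one_sub_eq (R := integralClosure ℤ ℂ) hp
    (by exact_mod_cast hp.ne_zero) (not_isUnit_natCast_integralClosure hp) s e J
    (fun j => μ (χ j)) (fun j _ => hμ _)
    (fun j hj h => (hχ j hj).2 (by simpa [μ] using congrArg Subtype.val h))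
    (n * ∑ θ ∈ t, (a θ : integralClosure ℤ ℂ) * (μ θ - 1)) ?_ ?_
  · rw [mul_pow]
    exact (prime_dvd_sum_sub_one_pow hp s t a μ fun θ _ => hμ θ).mul_left _
  · apply Subtype.ext
    have h := (ha y).trans (ht y hyK)
    rw [hn] at h
    push_cast at h ⊢
    simp only [μ, mul_sub, mul_one, Finset.sum_sub_distrib, hzero, sub_zero]
    rw [h, mul_assoc]

theorem mul_pred_lt_card_of_compl_cover_finite {G : Type*} [AddCommGroup G] [Finite G] {p : ℕ}
    (hp : p.Prime) (K : AddSubgroup G) {e : ℕ} (he : 1 ≤ e) (hK : p ^ e ∣ K.index)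
    {ι : Type*} (J : Finset ι) (S : ι → AddSubgroup G) {x : G}
    (hxK : x ∈ K) (hxS : ∀ j ∈ J, x ∉ S j) (hcov : ∀ g ∉ K, ∃ j ∈ J, g ∈ S j) :
    e * (p - 1) < J.card := by
  classical
  obtain ⟨s, m, hpm, hcard⟩ := Nat.exists_eq_pow_mul_and_not_dvd (Nat.card_pos (α := G)).ne' p
    hp.ne_one
  have hcop : Nat.Coprime (p ^ s) m := ((Nat.Prime.coprime_iff_not_dvd hp).2 hpm).pow_left s
  obtain ⟨u, v, huv⟩ : ∃ u v : ℤ, (p ^ s : ℕ) * u + m * v = 1 :=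
    ⟨_, _, by rw [← Nat.gcd_eq_gcd_ab, hcop]; rfl⟩
  let P : AddSubgroup G := (nsmulAddMonoidHom (α := G) m).range
  have hP : ∀ g : P, p ^ s • g = 0 := by
    rintro ⟨_, g, rfl⟩
    apply Subtype.ext
    change p ^ s • m • g = 0
    rw [← mul_nsmul', ← hcard, card_nsmul_eq_zero']
  have hPi : Nat.Coprime p P.index := by
    rw [Nat.Prime.coprime_iff_not_dvd hp]
    intro hdvd
    have := Fintype.ofFinite (G ⧸ P)
    have := Fact.mk hp
    obtain ⟨q, hq⟩ := exists_prime_addOrderOf_dvd_card (G := G ⧸ P) p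
      (by rwa [← Nat.card_eq_fintype_card])
    refine hpm (hq ▸ addOrderOf_dvd_of_nsmul_eq_zero ?_)
    obtain ⟨g, rfl⟩ := QuotientAddGroup.mk_surjective q
    exact (QuotientAddGroup.eq_zero_iff (m • g)).2 ⟨g, rfl⟩
  have hKP : p ^ e ∣ (K.addSubgroupOf P).index := by
    have h : K.relIndex P * P.index = P.relIndex K * K.index := by
      rw [← AddSubgroup.inf_relIndex_right, AddSubgroup.relIndex_mul_index inf_le_right,
        ← AddSubgroup.inf_relIndex_left, AddSubgroup.relIndex_mul_index inf_le_left]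
    refine (hPi.pow_left e).dvd_of_dvd_mul_right ?_
    change p ^ e ∣ K.relIndex P * P.index
    exact h ▸ hK.mul_left _
  set z : G := u • p ^ s • x with hz
  set y : G := m • v • x with hy
  have hx : z + y = x := by
    rw [hz, hy, ← natCast_zsmul, ← natCast_zsmul, smul_smul, smul_smul, ← add_smul,
      mul_comm u, huv, one_smul]
  have hyP : y ∈ P := ⟨v • x, rfl⟩
  have hzK : z ∈ K := K.zsmul_mem (K.nsmul_mem hxK _) _
  refine (mul_pred_lt_card_of_compl_cover (G := P) hp s hP (K.addSubgroupOf P) he hKP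
    (J.filter fun j => z ∈ S j) (fun j => (S j).addSubgroupOf P) (y := ⟨y, hyP⟩) ?_ ?_ ?_).trans_le
    (Finset.card_filter_le _ _)
  · exact K.nsmul_mem (K.zsmul_mem hxK _) _
  · intro j hj h
    rw [Finset.mem_filter] at hj
    exact hxS j hj.1 (hx ▸ (S j).add_mem hj.2 h)
  · rintro ⟨h, hhP⟩ hhK
    have hhK' : h ∉ K := hhK
    obtain ⟨j, hj, hjs⟩ := hcov (z + h) fun hc => hhK' ((K.add_mem_cancel_left hzK).1 hc)
    have hh0 : p ^ s • h = 0 := congrArg Subtype.val (hP ⟨h, hhP⟩)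
    have hmz : m • z = 0 := by
      rw [hz, smul_comm m u, ← mul_nsmul, ← hcard, card_nsmul_eq_zero', smul_zero]
    have hzS : z ∈ S j := by
      have h1 : z = (u * (p ^ s : ℕ)) • (z + h) := by
        have h2 : (m * v) • z = 0 := by rw [mul_comm, mul_smul, natCast_zsmul, hmz, smul_zero]
        rw [smul_add, mul_smul u _ h, natCast_zsmul, hh0, smul_zero, add_zero, mul_comm u,
          ← add_zero (((p ^ s : ℕ) * u) • z), ← h2, ← add_smul, huv, one_smul]
      rw [h1]
      exact (S j).zsmul_mem hjs _
    exact ⟨j, Finset.mem_filter.2 ⟨hj, hzS⟩, ((S j).add_mem_cancel_left hzS).1 hjs⟩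

/-- If an irredundant covering `C` of `ℤ²` contains a lattice whose index
has `p`-adic valuation `e ≥ 1`, then `C` has at least `e(p − 1) + 2` members. -/
theorem size_lower_bound_prime_power (C : Finset (AddSubgroup Z2))
    (hcov : IsCovering C) (hirr : Irredundant C)
    (p : ℕ) (hp : p.Prime) (L : AddSubgroup Z2) (hL : L ∈ C)
    (e : ℕ) (he : 1 ≤ e) (hval : (L.index).factorization p = e) :
    e * (p - 1) + 2 ≤ C.card := by
  classical
  let D : AddSubgroup Z2 := ⨅ M ∈ C, M
  have hD : D.FiniteIndex := AddSubgroup.finiteIndex_iInf' _ fun M hM => ⟨hcov.1 M hM⟩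
  have hDle : ∀ M ∈ C, D ≤ M := fun M hM => iInf₂_le M hM
  let f := QuotientAddGroup.mk' D
  have hmem : ∀ M ∈ C, ∀ v, f v ∈ M.map f ↔ v ∈ M := fun M hM v => by
    rw [← AddSubgroup.mem_comap, QuotientAddGroup.comap_map_mk', sup_eq_right.2 (hDle M hM)]
  have hindex : (L.map f).index = L.index :=
    L.index_map_eq (QuotientAddGroup.mk'_surjective D)
      ((QuotientAddGroup.ker_mk' D).trans_le (hDle L hL))
  obtain ⟨x, hxL, hx⟩ := hirr L hL
  have h := mul_pred_lt_card_of_compl_cover_finite (G := Z2 ⧸ D) hp (L.map f) he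
    (hindex ▸ hval ▸ Nat.ordProj_dvd _ _) (C.erase L) (fun M => M.map f) (x := f x)
    ((hmem L hL x).2 hxL)
    (fun M hM h => hx M (Finset.mem_of_mem_erase hM) (Finset.ne_of_mem_erase hM)
      ((hmem M (Finset.mem_of_mem_erase hM) x).1 h))
    (fun g hg => by
      obtain ⟨v, rfl⟩ := QuotientAddGroup.mk'_surjective D g
      obtain ⟨M, hM, hv⟩ := hcov.2 v
      refine ⟨M, Finset.mem_erase.2 ⟨?_, hM⟩, (hmem M hM v).2 hv⟩
      rintro rfl
      exact hg ((hmem M hM v).2 hv))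
  rw [Finset.card_erase_of_mem hL] at h
  omega
end

section
/- Let p be a prime and let 𝒞 be an irredundant covering of ℤ² of size n such that the least common multiple of the indices of the lattices in 𝒞 equals p^e with e ≥ 1. Then n = k(p − 1) + 2 for some integer k ≥ e; in particular n ≡ 2 (mod p − 1), and if p ≠ 2 then n is even. -/
/-- If the weights `p ^ (e - c i)`, `c i ≤ e`, add up to `m * p ^ e` and some `c i` equals `e`, then
the number of summands exceeds `m` by `k * (p - 1)` for some `k ≥ e`. -/
theorem exists_card_eq_of_sum_pow_sub {ι : Type*} {p : ℕ} (hp : 1 ≤ p) (e m : ℕ) (s : Finset ι)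
    (c : ι → ℕ) (hc : ∀ i ∈ s, c i ≤ e) (hmax : ∃ i ∈ s, c i = e)
    (hsum : ∑ i ∈ s, p ^ (e - c i) = m * p ^ e) :
    ∃ k, e ≤ k ∧ s.card = m + k * (p - 1) := by
  induction e generalizing m s c with
  | zero => exact ⟨0, le_rfl, by simpa using hsum⟩
  | succ e ih =>
    obtain ⟨i, hi, hie⟩ := hmax
    have hzero : ∑ i ∈ s with c i = 0, p ^ (e + 1 - c i)
        = (s.filter fun i => c i = 0).card * p ^ (e + 1) := by
      rw [Finset.sum_congr rfl (g := fun _ => p ^ (e + 1)), Finset.sum_const, smul_eq_mul]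
      intro j hj
      simp [(Finset.mem_filter.1 hj).2]
    have hpos : ∑ i ∈ s with ¬ c i = 0, p ^ (e + 1 - c i)
        = ∑ i ∈ s with ¬ c i = 0, p ^ (e - (c i - 1)) := by
      refine Finset.sum_congr rfl fun j hj => ?_
      have := (Finset.mem_filter.1 hj).2
      congr 1
      omega
    have hcard := Finset.card_filter_add_card_filter_not (s := s) (fun i => c i = 0)
    rw [← Finset.sum_filter_add_sum_filter_not s (fun i => c i = 0), hzero, hpos] at hsum
    have hi' : i ∈ s.filter fun i => ¬ c i = 0 := by simp [hi, hie]
    have hlt : (s.filter fun i => c i = 0).card < m := by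
      have h1 : 0 < ∑ i ∈ s with ¬ c i = 0, p ^ (e - (c i - 1)) :=
        Finset.sum_pos (fun _ _ => by positivity) ⟨i, hi'⟩
      have h2 : (s.filter fun i => c i = 0).card * p ^ (e + 1) < m * p ^ (e + 1) := by omega
      exact lt_of_mul_lt_mul_right h2 (Nat.zero_le _)
    obtain ⟨r, rfl⟩ := Nat.exists_eq_add_of_lt hlt
    obtain ⟨q, rfl⟩ := Nat.exists_eq_add_of_le' hp
    obtain ⟨k, hk, hk'⟩ := ih ((q + 1) * (r + 1)) (s.filter fun i => ¬ c i = 0) (fun i => c i - 1)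
      (fun j hj => by have := hc j (Finset.mem_filter.1 hj).1; omega)
      ⟨i, hi', by omega⟩ (by
        apply Nat.add_left_cancel (n := (s.filter fun i => c i = 0).card * (q + 1) ^ (e + 1))
        rw [hsum]
        ring)
    refine ⟨k + (r + 1), by omega, ?_⟩
    rw [← hcard, hk', Nat.add_sub_cancel]
    ring

/-- A residue class modulo `m` has `k` representatives in `[0, m * k)`. -/
theorem card_filter_dvd_sub {m : ℕ} (hm : 0 < m) (k : ℕ) (r : ℤ) :
    ((Finset.Ico (0 : ℤ) (m * k)).filter fun t => (m : ℤ) ∣ t - r).card = k := by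
  have h := Int.Ico_filter_modEq_card 0 (m * k) (r := m) (by exact_mod_cast hm) r
  have hm' : (m : ℚ) ≠ 0 := by positivity
  have h1 : (((m * k : ℤ) : ℚ) - r) / ((m : ℤ) : ℚ)
      = (((0 : ℤ) : ℚ) - r) / ((m : ℤ) : ℚ) + ((k : ℤ) : ℚ) := by
    push_cast
    field_simp
    ring
  have h2 : (Finset.Ico (0 : ℤ) (m * k)).filter (fun t => (m : ℤ) ∣ t - r)
      = (Finset.Ico (0 : ℤ) (m * k)).filter (fun t => t ≡ r [ZMOD m]) := by
    refine Finset.filter_congr fun t _ => ?_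
    rw [← Int.modEq_iff_dvd]
    exact ⟨Int.ModEq.symm, Int.ModEq.symm⟩
  rw [h1, Int.ceil_add_intCast] at h
  rw [h2]
  omega

/-- The solutions in `[0, m * k)` of a linear congruence with invertible leading coefficient. -/
theorem card_filter_dvd_mul_sub {m : ℕ} (hm : 0 < m) (k : ℕ) {a : ℤ} (b : ℤ)
    (ha : IsCoprime a (m : ℤ)) :
    ((Finset.Ico (0 : ℤ) (m * k)).filter fun t => (m : ℤ) ∣ a * t - b).card = k := by
  obtain ⟨u, w, huw⟩ := ha
  refine Eq.trans ?_ (card_filter_dvd_sub hm k (u * b))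
  refine congrArg Finset.card (Finset.filter_congr fun t _ => ⟨?_, ?_⟩)
  · rintro ⟨x, hx⟩
    exact ⟨u * x + w * t, by linear_combination u * hx - t * huw⟩
  · rintro ⟨x, hx⟩
    exact ⟨a * x - w * b, by linear_combination a * hx + b * huw⟩

/-- A lattice of index `N` containing a primitive vector `v` consists of the vectors `w` with
`det (v, w)` divisible by `N`. -/
theorem mem_iff_dvd_det {L : AddSubgroup Z2} {N : ℕ} (hN : N ≠ 0) (hL : L.index = N) {v : Z2}
    (hv : v ∈ L) (hprim : IsCoprime v.1 v.2) (w : Z2) :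
    w ∈ L ↔ (N : ℤ) ∣ v.1 * w.2 - v.2 * w.1 := by
  obtain ⟨x, y, hxy⟩ := hprim
  let φ : Z2 →+ ZMod N := (Int.castAddHom (ZMod N)).comp
    (AddMonoidHom.mk' (fun w : Z2 => v.1 * w.2 - v.2 * w.1) fun a b => by
      simp only [Prod.fst_add, Prod.snd_add]
      ring)
  have hφ : ∀ w, w ∈ φ.ker ↔ (N : ℤ) ∣ v.1 * w.2 - v.2 * w.1 := fun w =>
    ZMod.intCast_zmod_eq_zero_iff_dvd _ _
  have hle : φ.ker ≤ L := by
    intro w hw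
    obtain ⟨d, hd⟩ := (hφ w).1 hw
    have hdecomp : w = (x * w.1 + y * w.2) • v + N • (d • ((-y, x) : Z2)) := by
      ext
      · simp only [Prod.fst_add, Prod.smul_fst]
        simp only [smul_eq_mul, nsmul_eq_mul]
        linear_combination (-w.1) * hxy + (-y) * hd
      · simp only [Prod.snd_add, Prod.smul_snd]
        simp only [smul_eq_mul, nsmul_eq_mul]
        linear_combination (-w.2) * hxy + x * hd
    rw [hdecomp]
    refine L.add_mem (L.zsmul_mem hv _) ?_
    rw [← hL]
    exact L.nsmul_index_mem _
  have hsurj : Function.Surjective φ := by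
    intro z
    obtain ⟨d, rfl⟩ := ZMod.intCast_surjective z
    refine ⟨d • ((-y, x) : Z2), ?_⟩
    change ((v.1 * (d * x) - v.2 * (d * -y) : ℤ) : ZMod N) = (d : ZMod N)
    congr 1
    linear_combination d * hxy
  have hindex : φ.ker.index = N := by
    rw [AddSubgroup.index_ker, AddMonoidHom.range_eq_top.2 hsurj, AddSubgroup.card_top,
      Nat.card_zmod]
  have hrel := AddSubgroup.relIndex_mul_index hle
  rw [hindex, hL] at hrel
  have hge : L ≤ φ.ker :=
    AddSubgroup.relIndex_eq_one.1 (Nat.eq_of_mul_eq_mul_right (Nat.pos_of_ne_zero hN)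
      (by rw [hrel, one_mul]))
  rw [← hφ]
  exact ⟨fun h => hge h, fun h => hle h⟩

/-- A lattice of index `p ^ (c + 1)` containing a primitive vector contains exactly `p ^ (d - c)`
of the representatives `(1, t)`, `(p * s, 1)` of the projective line over `ℤ / p ^ (d + 1)`. -/
theorem card_projective_reps {p : ℕ} (hp : p.Prime) {L : AddSubgroup Z2} {c d : ℕ} (hcd : c ≤ d)
    (hL : L.index = p ^ (c + 1)) {v : Z2} (hv : v ∈ L) (hprim : IsCoprime v.1 v.2)
    [DecidablePred (· ∈ L)] :
    ((Finset.Ico (0 : ℤ) (p ^ (d + 1) : ℕ)).filter fun t => ((1, t) : Z2) ∈ L).card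
      + ((Finset.Ico (0 : ℤ) (p ^ d : ℕ)).filter fun s => ((p * s, 1) : Z2) ∈ L).card
      = p ^ (d - c) := by
  have hmem := mem_iff_dvd_det (pow_ne_zero _ hp.ne_zero) hL hv hprim
  have hpz : Prime (p : ℤ) := Nat.prime_iff_prime_int.1 hp
  have hpL : (p : ℤ) ∣ ((p ^ (c + 1) : ℕ) : ℤ) := by
    push_cast
    exact dvd_pow_self _ (Nat.succ_ne_zero c)
  by_cases ha : (p : ℤ) ∣ v.1
  · have hb : ¬ (p : ℤ) ∣ v.2 := fun hb => hpz.not_isUnit (hprim.isUnit_of_dvd' ha hb)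
    obtain ⟨a, ha⟩ := ha
    have h1 : (Finset.Ico (0 : ℤ) (p ^ (d + 1) : ℕ)).filter (fun t => ((1, t) : Z2) ∈ L) = ∅ := by
      refine Finset.filter_eq_empty_iff.2 fun t _ ht => hb ?_
      have h := hpL.trans ((hmem _).1 ht)
      have : v.2 = p * (a * t) - (v.1 * t - v.2 * 1) := by rw [ha]; ring
      rw [this]
      exact dvd_sub (dvd_mul_right _ _) h
    have h2 : (Finset.Ico (0 : ℤ) (p ^ d : ℕ)).filter (fun s => ((p * s, 1) : Z2) ∈ L)
        = (Finset.Ico (0 : ℤ) ((p ^ c : ℕ) * (p ^ (d - c) : ℕ))).filter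
          (fun s => ((p ^ c : ℕ) : ℤ) ∣ v.2 * s - a) := by
      have h : ((p ^ d : ℕ) : ℤ) = (p ^ c : ℕ) * (p ^ (d - c) : ℕ) := by
        rw [← Nat.cast_mul, ← pow_add, Nat.add_sub_cancel' hcd]
      rw [h]
      refine Finset.filter_congr fun s _ => ?_
      rw [hmem, ha, ← dvd_neg]
      have h3 : -((p : ℤ) * a * 1 - v.2 * (p * s)) = p * (v.2 * s - a) := by ring
      have h4 : ((p ^ (c + 1) : ℕ) : ℤ) = p * (p ^ c : ℕ) := by push_cast; ring
      simp only [h3, h4]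
      exact mul_dvd_mul_iff_left hpz.ne_zero
    rw [h1, h2, Finset.card_empty, zero_add]
    refine card_filter_dvd_mul_sub (pow_pos hp.pos _) _ _ ?_
    push_cast
    exact ((Prime.coprime_iff_not_dvd hpz).2 hb).symm.pow_right
  · have h1 : (Finset.Ico (0 : ℤ) (p ^ d : ℕ)).filter (fun s => ((p * s, 1) : Z2) ∈ L) = ∅ := by
      refine Finset.filter_eq_empty_iff.2 fun s _ hs => ha ?_
      have h := hpL.trans ((hmem _).1 hs)
      have : v.1 = (v.1 * 1 - v.2 * (p * s)) + p * (v.2 * s) := by ring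
      rw [this]
      exact dvd_add h (dvd_mul_right _ _)
    have h2 : (Finset.Ico (0 : ℤ) (p ^ (d + 1) : ℕ)).filter (fun t => ((1, t) : Z2) ∈ L)
        = (Finset.Ico (0 : ℤ) ((p ^ (c + 1) : ℕ) * (p ^ (d - c) : ℕ))).filter
          (fun t => ((p ^ (c + 1) : ℕ) : ℤ) ∣ v.1 * t - v.2) := by
      have h : ((p ^ (d + 1) : ℕ) : ℤ) = (p ^ (c + 1) : ℕ) * (p ^ (d - c) : ℕ) := by
        rw [← Nat.cast_mul, ← pow_add]
        congr 2
        omega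
      rw [h]
      refine Finset.filter_congr fun t _ => ?_
      rw [hmem, mul_one]
    rw [h1, h2, Finset.card_empty, add_zero]
    refine card_filter_dvd_mul_sub (pow_pos hp.pos _) _ _ ?_
    push_cast
    exact ((Prime.coprime_iff_not_dvd hpz).2 ha).symm.pow_right

/-- Every integer vector is a multiple of a primitive one. -/
theorem exists_primitive_smul_eq (w : Z2) : ∃ (g : ℤ) (v : Z2), IsCoprime v.1 v.2 ∧ w = g • v := by
  by_cases hw : 0 < Int.gcd w.1 w.2
  · obtain ⟨a, b, hab, ha, hb⟩ := Int.exists_gcd_one hw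
    refine ⟨Int.gcd w.1 w.2, (a, b), Int.isCoprime_iff_gcd_eq_one.2 hab, ?_⟩
    ext
    · simp only [Prod.smul_fst, smul_eq_mul]
      rw [mul_comm]
      exact ha
    · simp only [Prod.smul_snd, smul_eq_mul]
      rw [mul_comm]
      exact hb
  · obtain ⟨h1, h2⟩ := Int.gcd_eq_zero_iff.1 (Nat.eq_zero_of_not_pos hw)
    refine ⟨0, (1, 0), isCoprime_one_left, ?_⟩
    ext <;> simp [h1, h2]

/-- Every lattice of an irredundant covering contains a primitive vector. -/
theorem Irredundant.exists_primitive_mem {C : Finset (AddSubgroup Z2)} (hirr : Irredundant C)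
    (hcov : IsCovering C) {L : AddSubgroup Z2} (hL : L ∈ C) : ∃ v ∈ L, IsCoprime v.1 v.2 := by
  obtain ⟨w, _, hw⟩ := hirr L hL
  obtain ⟨g, v, hv, rfl⟩ := exists_primitive_smul_eq w
  obtain ⟨L', hL', hvL'⟩ := hcov.2 v
  have h : L' = L := by
    by_contra hne
    exact hw L' hL' hne (L'.zsmul_mem hvL' g)
  exact ⟨v, h ▸ hvL', hv⟩

/-- Distinct members of an irredundant family are not nested. -/
theorem Irredundant.eq_of_le {C : Finset (AddSubgroup Z2)} (hirr : Irredundant C)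
    {L L' : AddSubgroup Z2} (hL : L ∈ C) (hL' : L' ∈ C) (hle : L ≤ L') : L = L' := by
  obtain ⟨v, hv, h⟩ := hirr L hL
  by_contra hne
  exact h L' hL' (Ne.symm hne) (hle hv)

/-- Two lattices of indices `M ∣ N` sharing a primitive vector are nested. -/
theorem le_of_primitive_mem {L L' : AddSubgroup Z2} {M N : ℕ} (hN : N ≠ 0)
    (hMN : M ∣ N) (hL : L.index = N) (hL' : L'.index = M) {v : Z2} (hv : v ∈ L) (hv' : v ∈ L')
    (hprim : IsCoprime v.1 v.2) : L ≤ L' := by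
  intro w hw
  rw [mem_iff_dvd_det (ne_zero_of_dvd_ne_zero hN hMN) hL' hv' hprim]
  exact (Int.natCast_dvd_natCast.2 hMN).trans ((mem_iff_dvd_det hN hL hv hprim w).1 hw)

/-- In a family of sets of which each `f t` lies in exactly one, the numbers of `t` in the
members add up to the total number. -/
theorem sum_card_filter_mem {C : Finset (AddSubgroup Z2)} {ι : Type*} (T : Finset ι) (f : ι → Z2)
    [∀ L : AddSubgroup Z2, DecidablePred (· ∈ L)] (h : ∀ t ∈ T, ∃! L, L ∈ C ∧ f t ∈ L) :
    ∑ L ∈ C, (T.filter fun t => f t ∈ L).card = T.card := by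
  rw [Finset.card_eq_sum_ones]
  simp only [Finset.card_filter]
  rw [Finset.sum_comm]
  refine Finset.sum_congr rfl fun t ht => ?_
  obtain ⟨L, ⟨hL, hfL⟩, huniq⟩ := h t ht
  rw [Finset.sum_eq_single L, if_pos hfL]
  · intro L' hL' hne
    exact if_neg fun hf => hne (huniq L' ⟨hL', hf⟩)
  · exact fun hn => absurd hL hn

/-- Let `p` be prime and `C` an irredundant covering of `ℤ²` of size `n`
whose indices have lcm `p^e` with `e ≥ 1`. Then `n = k(p − 1) + 2` for some `k ≥ e`;
in particular `n ≡ 2 (mod p − 1)`, and if `p ≠ 2` then `n` is even. -/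
theorem size_congruence_prime_power_lcm (p : ℕ) (hp : p.Prime)
    (C : Finset (AddSubgroup Z2)) (hcov : IsCovering C) (hirr : Irredundant C)
    (n : ℕ) (hn : C.card = n) (e : ℕ) (he : 1 ≤ e)
    (hlcm : (C.lcm fun L => L.index) = p ^ e) :
    (∃ k : ℕ, e ≤ k ∧ n = k * (p - 1) + 2) ∧
    n ≡ 2 [MOD p - 1] ∧
    (p ≠ 2 → Even n) := by
  classical
  obtain ⟨d, rfl⟩ := Nat.exists_eq_add_of_le' he
  have hindex : ∀ L ∈ C, ∃ c, c ≤ d ∧ L.index = p ^ (c + 1) := by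
    intro L hL
    have hdvd : L.index ∣ p ^ (d + 1) := hlcm ▸ Finset.dvd_lcm (f := fun L => L.index) hL
    obtain ⟨c, hc, hLc⟩ := (Nat.dvd_prime_pow hp).1 hdvd
    rcases c with _ | c
    · have htop : L = ⊤ := AddSubgroup.index_eq_one.1 (by simpa using hLc)
      have hone : (C.lcm fun L => L.index) ∣ 1 := Finset.lcm_dvd fun L' hL' => by
        rw [hirr.eq_of_le hL' hL (htop ▸ le_top), hLc, pow_zero]
      rw [hlcm, Nat.dvd_one, Nat.pow_eq_one] at hone
      have := hp.one_lt
      omega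
    · exact ⟨c, by omega, hLc⟩
  choose! c hcd hindex using hindex
  have hmax : ∃ L ∈ C, c L = d := by
    by_contra! hne
    have hdvd : (C.lcm fun L => L.index) ∣ p ^ d := Finset.lcm_dvd fun L hL => by
      have := hcd L hL
      have := hne L hL
      rw [hindex L hL]
      exact pow_dvd_pow _ (by omega)
    rw [hlcm, Nat.pow_dvd_pow_iff_le_right hp.one_lt] at hdvd
    omega
  have huniq : ∀ v : Z2, IsCoprime v.1 v.2 → ∃! L, L ∈ C ∧ v ∈ L := by
    intro v hprim
    have hnested : ∀ L ∈ C, ∀ L' ∈ C, v ∈ L → v ∈ L' → c L' ≤ c L → L = L' :=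
      fun L hL L' hL' hv hv' hcc => hirr.eq_of_le hL hL'
        (le_of_primitive_mem (pow_ne_zero _ hp.ne_zero) (pow_dvd_pow p (Nat.succ_le_succ hcc))
          (hindex L hL) (hindex L' hL') hv hv' hprim)
    obtain ⟨L, hL, hv⟩ := hcov.2 v
    refine ⟨L, ⟨hL, hv⟩, fun L' hL' => ?_⟩
    rcases le_total (c L) (c L') with h | h
    · exact hnested L' hL'.1 L hL hL'.2 hv h
    · exact (hnested L hL L' hL'.1 hv hL'.2 h).symm
  have hsum : ∑ L ∈ C, p ^ (d - c L) = (p + 1) * p ^ d := by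
    have h1 := sum_card_filter_mem (C := C) (Finset.Ico (0 : ℤ) (p ^ (d + 1) : ℕ))
      (fun t => ((1, t) : Z2)) fun t _ => huniq _ isCoprime_one_left
    have h2 := sum_card_filter_mem (C := C) (Finset.Ico (0 : ℤ) (p ^ d : ℕ))
      (fun s => ((p * s, 1) : Z2)) fun s _ => huniq _ isCoprime_one_right
    have h3 := congrArg₂ (· + ·) h1 h2
    simp only [← Finset.sum_add_distrib, Int.card_Ico, sub_zero, Int.toNat_natCast] at h3
    calc ∑ L ∈ C, p ^ (d - c L) = p ^ (d + 1) + p ^ d := by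
          rw [← h3]
          refine Finset.sum_congr rfl fun L hL => ?_
          obtain ⟨v, hv, hprim⟩ := hirr.exists_primitive_mem hcov hL
          exact (card_projective_reps hp (hcd L hL) (hindex L hL) hv hprim).symm
      _ = (p + 1) * p ^ d := by ring
  obtain ⟨k, hk, hcard⟩ := exists_card_eq_of_sum_pow_sub hp.one_le d (p + 1) C c hcd hmax hsum
  have hn' : n = (k + 1) * (p - 1) + 2 := by
    have hp1 : p = (p - 1) + 1 := (Nat.sub_add_cancel hp.one_le).symm
    rw [← hn, hcard, add_one_mul]
    omega
  refine ⟨⟨k + 1, by omega, hn'⟩, ?_, fun hp2 => ?_⟩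
  · rw [hn', Nat.ModEq, Nat.mul_add_mod_self_right]
  · rw [hn']
    exact ((hp.even_sub_one hp2).mul_left _).add even_two
end
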